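/- arXiv:1305.5261 — 2 statements merged into one kernel-verified Lean document; each statement's English description precedes it below -/
import Mathlib

section
/- There is an absolute constant C such that for every T > 0, every r0* < −1, and every smooth function φ on [0,T]×ℝ that is compactly supported in r* for each s, one has, uniformly in r0* and T: ||χ_{[r0*,∞)} ∂_s φ||_{LE_RW[0,T]} + ||χ_{[r0*,∞)} ∂_{r*} φ||_{LE_RW[0,T]} ≤ C ( ||χ_{[2r0*, r0*]} ∂_s φ||_{LE_RW[0,T]} + ||χ_{[2r0*, r0*]} ∂_{r*} φ||_{LE_RW[0,T]} + E_{RW, r* > 2r0*}(φ[0])^{1/2} + ||χ_{[2r0*,∞)} □φ||_{LE*_RW[0,T]} ). (This is the paper's truncated local energy decay estimate for the Regge–Wheeler wave operator acting on spherically symmetric functions.) -/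
open MeasureTheory

noncomputable section

/-- Partial derivative in the first (time) variable `s`. -/
def pds (φ : ℝ → ℝ → ℝ) (s x : ℝ) : ℝ := deriv (fun u => φ u x) s

/-- Partial derivative in the second (space) variable `r*`. -/
def pdrs (φ : ℝ → ℝ → ℝ) (s x : ℝ) : ℝ := deriv (fun y => φ s y) x

/-- The Regge–Wheeler d'Alembertian `□ = −∂_s² + ∂_{r*}²`. -/
def boxRW (φ : ℝ → ℝ → ℝ) (s x : ℝ) : ℝ :=
  -(deriv (fun u => pds φ u x) s) + deriv (fun y => pdrs φ s y) x

/-- The dyadic regions: `χ_0` is the indicator of `{|r*| < 2}` and, for `j ≥ 1`,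
`χ_j` is the indicator of `{2^j ≤ |r*| < 2^{j+1}}`. -/
def dyadicAnn (j : ℕ) : Set ℝ :=
  if j = 0 then {x : ℝ | |x| < 2} else {x : ℝ | (2 : ℝ) ^ j ≤ |x| ∧ |x| < (2 : ℝ) ^ (j + 1)}

/-- `‖ψ‖_{LE_RW[0,T]} = sup_{j≥0} 2^{-j/2} ‖χ_j ψ‖_{L²(dr* ds)}`. -/
def LERW (ψ : ℝ → ℝ → ℝ) (T : ℝ) : ℝ :=
  ⨆ j : ℕ, (2 : ℝ) ^ (-(j : ℝ) / 2) *
    Real.sqrt (∫ s in Set.Ioc (0 : ℝ) T, ∫ x in dyadicAnn j, ψ s x ^ 2)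

/-- `‖ψ‖_{LE*_RW[0,T]} = Σ_{j≥0} 2^{j/2} ‖χ_j ψ‖_{L²(dr* ds)}`. -/
def LERWstar (ψ : ℝ → ℝ → ℝ) (T : ℝ) : ℝ :=
  ∑' j : ℕ, (2 : ℝ) ^ ((j : ℝ) / 2) *
    Real.sqrt (∫ s in Set.Ioc (0 : ℝ) T, ∫ x in dyadicAnn j, ψ s x ^ 2)

/-- Multiplication by the sharp cutoff `χ_I` of a set `I ⊂ ℝ` in the space variable. -/
def cut (I : Set ℝ) (ψ : ℝ → ℝ → ℝ) : ℝ → ℝ → ℝ := fun s x => I.indicator (ψ s) x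

/-- The truncated energy `E_{RW, r* > a}(φ[s₀]) = ∫_a^∞ ((∂_sφ)² + (∂_{r*}φ)²)(s₀,·) dr*`. -/
def energyRW (φ : ℝ → ℝ → ℝ) (s₀ a : ℝ) : ℝ :=
  ∫ x in Set.Ioi a, ((pds φ s₀ x) ^ 2 + (pdrs φ s₀ x) ^ 2)

/-- A set integral of a nonnegative function is bounded by the sum over a finite cover. -/
lemma setIntegral_le_sum_of_subset_biUnion {α ι : Type*} [MeasurableSpace α] {μ : Measure α}
    {f : α → ℝ} (hf : ∀ x, 0 ≤ f x) (F : Finset ι) (t : ι → Set α) {s : Set α}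
    (hs : s ⊆ ⋃ j ∈ F, t j) (hi : ∀ j ∈ F, IntegrableOn f (t j) μ) :
    ∫ x in s, f x ∂μ ≤ ∑ j ∈ F, ∫ x in t j, f x ∂μ := by
  classical
  have hI : IntegrableOn f (⋃ j ∈ F, t j) μ := integrableOn_finset_iUnion.2 hi
  have hs' : ∫ x in s, f x ∂μ ≤ ∫ x in ⋃ j ∈ F, t j, f x ∂μ :=
    setIntegral_mono_set hI (Filter.Eventually.of_forall hf) hs.eventuallyLE
  refine hs'.trans ?_
  clear hs hs' hI
  induction F using Finset.induction_on with
  | empty => simp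
  | insert a F ha ih =>
    have h1 : IntegrableOn f (t a) μ := hi a (Finset.mem_insert_self a F)
    have h2 : IntegrableOn f (⋃ j ∈ F, t j) μ :=
      integrableOn_finset_iUnion.2 fun j hj => hi j (Finset.mem_insert_of_mem hj)
    rw [Finset.sum_insert ha, Finset.set_biUnion_insert]
    refine (integral_mono_measure (Measure.restrict_union_le _ _)
      (Filter.Eventually.of_forall hf) (integrable_add_measure.2 ⟨h1, h2⟩)).trans ?_
    rw [integral_add_measure h1 h2]
    linarith [ih fun j hj => hi j (Finset.mem_insert_of_mem hj)]

/-- Cauchy–Schwarz for the set integral of continuous functions. -/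
lemma setIntegral_abs_mul_le_sqrt_mul_sqrt {α : Type*} [TopologicalSpace α] [MeasurableSpace α]
    [OpensMeasurableSpace α] [SecondCountableTopologyEither α ℝ]
    {μ : Measure α} {f g : α → ℝ} (hf : Continuous f) (hg : Continuous g)
    {s : Set α} (hfi : IntegrableOn (fun x => f x ^ 2) s μ)
    (hgi : IntegrableOn (fun x => g x ^ 2) s μ) :
    ∫ x in s, |f x * g x| ∂μ ≤
      Real.sqrt (∫ x in s, f x ^ 2 ∂μ) * Real.sqrt (∫ x in s, g x ^ 2 ∂μ) := by
  have h2 : ENNReal.ofReal 2 = 2 := by simp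
  have hf' : MemLp f (ENNReal.ofReal 2) (μ.restrict s) := by
    rw [h2]; exact (memLp_two_iff_integrable_sq hf.aestronglyMeasurable).2 hfi
  have hg' : MemLp g (ENNReal.ofReal 2) (μ.restrict s) := by
    rw [h2]; exact (memLp_two_iff_integrable_sq hg.aestronglyMeasurable).2 hgi
  have := integral_mul_norm_le_Lp_mul_Lq Real.HolderConjugate.two_two hf' hg'
  simpa [Real.sqrt_eq_rpow, abs_mul] using this

lemma Continuous.integrableOn_slab {f : ℝ × ℝ → ℝ} (hf : Continuous f) (T : ℝ) {B : Set ℝ}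
    {a b : ℝ} (hB : B ⊆ Set.Icc a b) : IntegrableOn f (Set.Ioc 0 T ×ˢ B) := by
  have hK : IsCompact (Set.Icc (0 : ℝ) T ×ˢ Set.Icc a b) := isCompact_Icc.prod isCompact_Icc
  exact (hf.continuousOn.integrableOn_compact hK).mono_set
    (Set.prod_mono Set.Ioc_subset_Icc_self hB)

lemma measurableSet_dyadicAnn (j : ℕ) : MeasurableSet (dyadicAnn j) := by
  unfold dyadicAnn
  split_ifs
  · exact measurableSet_lt continuous_abs.measurable measurable_const
  · exact (measurableSet_le measurable_const continuous_abs.measurable).inter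
      (measurableSet_lt continuous_abs.measurable measurable_const)

lemma dyadicAnn_subset_Icc (j : ℕ) :
    dyadicAnn j ⊆ Set.Icc (-((2 : ℝ) * 2 ^ j)) ((2 : ℝ) * 2 ^ j) := by
  intro x hx
  unfold dyadicAnn at hx
  rw [Set.mem_Icc, ← abs_le]
  split_ifs at hx with h
  · subst h; simpa using le_of_lt hx
  · have := hx.2.le; rw [pow_succ] at this; linarith

lemma inter_dyadicAnn_subset_Icc (j : ℕ) (B : Set ℝ) :
    dyadicAnn j ∩ B ⊆ Set.Icc (-((2 : ℝ) * 2 ^ j)) ((2 : ℝ) * 2 ^ j) :=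
  Set.inter_subset_left.trans (dyadicAnn_subset_Icc j)

lemma mem_dyadicAnn_of_lt {j : ℕ} {x : ℝ} (h1 : (2 : ℝ) ^ j ≤ |x|) (h2 : |x| < 2 ^ (j + 1)) :
    x ∈ dyadicAnn j := by
  unfold dyadicAnn
  split_ifs with h
  · subst h; simpa using h2
  · exact ⟨h1, h2⟩

lemma exists_mem_dyadicAnn {J : ℕ} {x : ℝ} (h : |x| < 2 ^ (J + 1)) :
    ∃ j < J + 1, x ∈ dyadicAnn j := by
  induction J with
  | zero => exact ⟨0, by simp, by simpa [dyadicAnn] using h⟩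
  | succ J ih =>
    by_cases hx : |x| < 2 ^ (J + 1)
    · obtain ⟨j, hj, hxj⟩ := ih hx
      exact ⟨j, by omega, hxj⟩
    · exact ⟨J + 1, by omega, mem_dyadicAnn_of_lt (not_lt.1 hx) h⟩

/-- The integrals in the dyadic norms of a cut-off function, as integrals over space-time slabs. -/
lemma integral_cut_sq_eq {ψ : ℝ → ℝ → ℝ} (hψ : Continuous fun p : ℝ × ℝ => ψ p.1 p.2)
    {B : Set ℝ} (hB : MeasurableSet B) (T : ℝ) (j : ℕ) :
    ∫ s in Set.Ioc (0 : ℝ) T, ∫ x in dyadicAnn j, cut B ψ s x ^ 2 =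
      ∫ p in Set.Ioc (0 : ℝ) T ×ˢ (dyadicAnn j ∩ B), ψ p.1 p.2 ^ 2 := by
  have h2 : IntegrableOn (fun p : ℝ × ℝ => ψ p.1 p.2 ^ 2)
      (Set.Ioc (0 : ℝ) T ×ˢ (dyadicAnn j ∩ B)) :=
    Continuous.integrableOn_slab (hψ.pow 2) T (inter_dyadicAnn_subset_Icc j B)
  rw [Measure.volume_eq_prod] at h2 ⊢
  rw [setIntegral_prod _ h2]
  refine integral_congr_ae (Filter.Eventually.of_forall fun s => ?_)
  have : ∀ x, cut B ψ s x ^ 2 = B.indicator (fun x => ψ s x ^ 2) x := by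
    intro x
    by_cases hx : x ∈ B <;> simp [cut, hx]
  simp only [this]
  exact setIntegral_indicator hB

/-- Only finitely many dyadic pieces of a function of compact spatial support are nonzero. -/
lemma summable_dyadic {ψ : ℝ → ℝ → ℝ} (hψ : Continuous fun p : ℝ × ℝ => ψ p.1 p.2)
    {R : ℝ} (hR : ∀ s x, R ≤ |x| → ψ s x = 0) {B : Set ℝ} (hB : MeasurableSet B) (T : ℝ)
    (c : ℕ → ℝ) :
    Summable fun j : ℕ => c j *
      Real.sqrt (∫ s in Set.Ioc (0 : ℝ) T, ∫ x in dyadicAnn j, cut B ψ s x ^ 2) := by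
  obtain ⟨J, hJ⟩ := pow_unbounded_of_one_lt R (one_lt_two : (1 : ℝ) < 2)
  refine summable_of_ne_finset_zero (s := Finset.range (J + 1)) fun j hj => ?_
  have hjJ : J + 1 ≤ j := by simpa using hj
  rw [integral_cut_sq_eq hψ hB, setIntegral_eq_zero_of_forall_eq_zero, Real.sqrt_zero, mul_zero]
  rintro ⟨s, x⟩ ⟨-, hx, -⟩
  have hx' : (2 : ℝ) ^ j ≤ |x| := by
    unfold dyadicAnn at hx
    rw [if_neg (by omega)] at hx
    exact hx.1
  have : (2 : ℝ) ^ J ≤ 2 ^ j := pow_le_pow_right₀ one_le_two (by omega)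
  simp [hR s x (by linarith)]

lemma two_rpow_neg_half_mul_sqrt_sq (j : ℕ) {A : ℝ} (hA : 0 ≤ A) :
    (2 : ℝ) ^ j * ((2 : ℝ) ^ (-(j : ℝ) / 2) * Real.sqrt A) ^ 2 = A := by
  rw [mul_pow, Real.sq_sqrt hA, ← Real.rpow_natCast ((2 : ℝ) ^ (-(j : ℝ) / 2)) 2,
    ← Real.rpow_mul (by norm_num), ← Real.rpow_natCast 2 j, ← mul_assoc,
    ← Real.rpow_add (by norm_num)]
  norm_num

lemma two_rpow_half_sq (j : ℕ) : ((2 : ℝ) ^ ((j : ℝ) / 2)) ^ 2 = 2 ^ j := by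
  rw [← Real.rpow_natCast ((2 : ℝ) ^ ((j : ℝ) / 2)) 2, ← Real.rpow_mul (by norm_num),
    ← Real.rpow_natCast 2 j]
  norm_num

lemma LERW_nonneg (ψ : ℝ → ℝ → ℝ) (T : ℝ) : 0 ≤ LERW ψ T :=
  Real.iSup_nonneg fun _ => by positivity

lemma LERWstar_nonneg (ψ : ℝ → ℝ → ℝ) (T : ℝ) : 0 ≤ LERWstar ψ T :=
  tsum_nonneg fun _ => by positivity

lemma integral_slab_sq_le_LERW {ψ : ℝ → ℝ → ℝ} (hψ : Continuous fun p : ℝ × ℝ => ψ p.1 p.2)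
    {R : ℝ} (hR : ∀ s x, R ≤ |x| → ψ s x = 0) {B : Set ℝ} (hB : MeasurableSet B) (T : ℝ)
    (j : ℕ) :
    ∫ p in Set.Ioc (0 : ℝ) T ×ˢ (dyadicAnn j ∩ B), ψ p.1 p.2 ^ 2 ≤
      2 ^ j * LERW (cut B ψ) T ^ 2 := by
  rw [← integral_cut_sq_eq hψ hB]
  have h0 : 0 ≤ ∫ s in Set.Ioc (0 : ℝ) T, ∫ x in dyadicAnn j, cut B ψ s x ^ 2 :=
    integral_nonneg fun s => integral_nonneg fun x => sq_nonneg _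
  nth_rewrite 1 [← two_rpow_neg_half_mul_sqrt_sq j h0]
  gcongr
  exact le_ciSup (f := fun j : ℕ => (2 : ℝ) ^ (-(j : ℝ) / 2) *
      Real.sqrt (∫ s in Set.Ioc (0 : ℝ) T, ∫ x in dyadicAnn j, cut B ψ s x ^ 2))
    (summable_dyadic hψ hR hB T _).tendsto_atTop_zero.bddAbove_range j

lemma LERW_le_of_integral_slab_sq_le {ψ : ℝ → ℝ → ℝ}
    (hψ : Continuous fun p : ℝ × ℝ => ψ p.1 p.2) {B : Set ℝ} (hB : MeasurableSet B) {T S : ℝ}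
    (hS : 0 ≤ S)
    (h : ∀ j, ∫ p in Set.Ioc (0 : ℝ) T ×ˢ (dyadicAnn j ∩ B), ψ p.1 p.2 ^ 2 ≤ 2 ^ j * S ^ 2) :
    LERW (cut B ψ) T ≤ S := by
  refine ciSup_le fun j => ?_
  have h0 : 0 ≤ ∫ s in Set.Ioc (0 : ℝ) T, ∫ x in dyadicAnn j, cut B ψ s x ^ 2 :=
    integral_nonneg fun s => integral_nonneg fun x => sq_nonneg _
  have hj := h j
  rw [← integral_cut_sq_eq hψ hB] at hj
  nth_rewrite 1 [← two_rpow_neg_half_mul_sqrt_sq j h0] at hj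
  exact (pow_le_pow_iff_left₀ (by positivity) hS two_ne_zero).1
    (le_of_mul_le_mul_left hj (by positivity))

lemma sum_sqrt_integral_slab_le_LERWstar {ψ : ℝ → ℝ → ℝ}
    (hψ : Continuous fun p : ℝ × ℝ => ψ p.1 p.2)
    {R : ℝ} (hR : ∀ s x, R ≤ |x| → ψ s x = 0) {B : Set ℝ} (hB : MeasurableSet B) (T : ℝ)
    (J : ℕ) :
    ∑ j ∈ Finset.range J, (2 : ℝ) ^ ((j : ℝ) / 2) *
      Real.sqrt (∫ p in Set.Ioc (0 : ℝ) T ×ˢ (dyadicAnn j ∩ B), ψ p.1 p.2 ^ 2) ≤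
      LERWstar (cut B ψ) T := by
  simp only [← integral_cut_sq_eq hψ hB]
  exact (summable_dyadic hψ hR hB T _).sum_le_tsum _ fun j _ => by positivity

/-- The `L²` energy identity for the transport operator `∂_s + σ ∂_x` on a rectangle. -/
lemma transport_energy_identity {w G : ℝ × ℝ → ℝ} (hw : ContDiff ℝ 1 w) (hG : Continuous G)
    {σ : ℝ} (hwG : ∀ p, fderiv ℝ w p (1, 0) + σ * fderiv ℝ w p (0, 1) = G p) (T a b : ℝ) :
    ∫ s in (0 : ℝ)..T, ∫ y in a..b, 2 * (w (s, y) * G (s, y)) =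
      σ * (∫ s in (0 : ℝ)..T, w (s, b) ^ 2) - σ * (∫ s in (0 : ℝ)..T, w (s, a) ^ 2)
        + (∫ y in a..b, w (T, y) ^ 2) - ∫ y in a..b, w (0, y) ^ 2 := by
  have hd : ∀ p, HasFDerivAt (fun p => w p ^ 2) ((2 * w p) • fderiv ℝ w p) p := fun p => by
    simpa using ((hw.differentiable one_ne_zero) p).hasFDerivAt.pow 2
  have hd' : ∀ p, HasFDerivAt (fun p => σ * w p ^ 2) (σ • ((2 * w p) • fderiv ℝ w p)) p :=
    fun p => (hd p).const_mul σ
  have hc : Continuous w := hw.continuous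
  have hval : ∀ p : ℝ × ℝ, ((2 * w p) • fderiv ℝ w p) (1, 0)
      + (σ • ((2 * w p) • fderiv ℝ w p)) (0, 1) = 2 * (w p * G p) := fun p => by
    rw [← hwG p]
    simp only [smul_apply, smul_eq_mul]
    ring
  have := integral2_divergence_prod_of_hasFDerivAt (fun p => w p ^ 2) (fun p => σ * w p ^ 2)
    (fun p => (2 * w p) • fderiv ℝ w p) (fun p => σ • ((2 * w p) • fderiv ℝ w p)) 0 a T b
    (by fun_prop) (by fun_prop) (fun p _ => hd p) (fun p _ => hd' p)
    (by
      simp only [hval]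
      exact ContinuousOn.integrableOn_compact (isCompact_uIcc.prod isCompact_uIcc) (by fun_prop))
  simp only [hval, intervalIntegral.integral_const_mul] at this ⊢
  exact this

/-- The flux through a line `x = const` is controlled by the flux through an upstream line, the
initial energy and the work of the source term. -/
lemma transport_flux_le {w G : ℝ × ℝ → ℝ} (hw : ContDiff ℝ 1 w) (hG : Continuous G)
    {σ : ℝ} (hwG : ∀ p, fderiv ℝ w p (1, 0) + σ * fderiv ℝ w p (0, 1) = G p) {T a b : ℝ}
    (hT : 0 ≤ T) (hab : a ≤ b) :
    σ * (∫ s in (0 : ℝ)..T, w (s, b) ^ 2) - σ * (∫ s in (0 : ℝ)..T, w (s, a) ^ 2) ≤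
      (∫ y in a..b, w (0, y) ^ 2) +
        2 * ∫ p in Set.Ioc (0 : ℝ) T ×ˢ Set.Ioc a b, |w p * G p| := by
  have hid := transport_energy_identity hw hG hwG T a b
  have hc : Continuous w := hw.continuous
  have hpos : 0 ≤ ∫ y in a..b, w (T, y) ^ 2 :=
    intervalIntegral.integral_nonneg hab fun _ _ => sq_nonneg _
  have hint : IntegrableOn (fun p => 2 * (w p * G p)) (Set.Ioc (0 : ℝ) T ×ˢ Set.Ioc a b) :=
    Continuous.integrableOn_slab (by fun_prop) T Set.Ioc_subset_Icc_self
  have hswap : ∫ s in (0 : ℝ)..T, ∫ y in a..b, 2 * (w (s, y) * G (s, y)) =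
      ∫ p in Set.Ioc (0 : ℝ) T ×ˢ Set.Ioc a b, 2 * (w p * G p) := by
    simp only [intervalIntegral.integral_of_le hT, intervalIntegral.integral_of_le hab]
    rw [Measure.volume_eq_prod] at hint ⊢
    rw [setIntegral_prod _ hint]
  have hle : ∫ p in Set.Ioc (0 : ℝ) T ×ˢ Set.Ioc a b, 2 * (w p * G p) ≤
      2 * ∫ p in Set.Ioc (0 : ℝ) T ×ˢ Set.Ioc a b, |w p * G p| := by
    rw [← integral_const_mul]
    refine integral_mono hint
      (Continuous.integrableOn_slab (by fun_prop) T Set.Ioc_subset_Icc_self) fun p => ?_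
    linarith [le_abs_self (w p * G p)]
  linarith

/-- Fubini: the slab integral of a square as an integral of fluxes. -/
lemma integral_slab_eq_integral_flux {w : ℝ × ℝ → ℝ} (hw : Continuous w) {T a b : ℝ}
    (hT : 0 ≤ T) {B : Set ℝ} (hB : B ⊆ Set.Icc a b) :
    ∫ p in Set.Ioc (0 : ℝ) T ×ˢ B, w p ^ 2 =
      ∫ x in B, ∫ s in (0 : ℝ)..T, w (s, x) ^ 2 := by
  have hint : IntegrableOn (fun p => w p ^ 2) (Set.Ioc (0 : ℝ) T ×ˢ B) :=
    Continuous.integrableOn_slab (hw.pow 2) T hB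
  simp only [intervalIntegral.integral_of_le hT]
  rw [Measure.volume_eq_prod] at hint ⊢
  rw [IntegrableOn, ← Measure.prod_restrict] at hint
  rw [← Measure.prod_restrict, integral_prod_symm _ hint]

/-- A uniform bound on the fluxes through a set of lines gives the dyadic bounds on slabs. -/
lemma integral_slab_sq_le_of_flux_le {w : ℝ × ℝ → ℝ} (hw : Continuous w) {T M : ℝ}
    (hT : 0 ≤ T) (hM : 0 ≤ M) {B : Set ℝ} (hB : MeasurableSet B)
    (h : ∀ x ∈ B, ∫ s in (0 : ℝ)..T, w (s, x) ^ 2 ≤ M) (j : ℕ) :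
    ∫ p in Set.Ioc (0 : ℝ) T ×ˢ (dyadicAnn j ∩ B), w p ^ 2 ≤ 2 ^ j * (4 * M) := by
  have hsub := inter_dyadicAnn_subset_Icc j B
  have hm : MeasurableSet (dyadicAnn j ∩ B) := (measurableSet_dyadicAnn j).inter hB
  have hcont : Continuous fun x => ∫ s in (0 : ℝ)..T, w (s, x) ^ 2 :=
    intervalIntegral.continuous_parametric_intervalIntegral_of_continuous' (by fun_prop) 0 T
  have hi : IntegrableOn (fun _ : ℝ => M) (Set.Icc (-((2 : ℝ) * 2 ^ j)) ((2 : ℝ) * 2 ^ j)) :=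
    continuousOn_const.integrableOn_compact isCompact_Icc
  rw [integral_slab_eq_integral_flux hw hT hsub]
  calc ∫ x in dyadicAnn j ∩ B, ∫ s in (0 : ℝ)..T, w (s, x) ^ 2
      ≤ ∫ x in dyadicAnn j ∩ B, M :=
        setIntegral_mono_on ((hcont.continuousOn.integrableOn_compact isCompact_Icc).mono_set hsub)
          (hi.mono_set hsub) hm fun x hx => h x hx.2
    _ ≤ ∫ x in Set.Icc (-((2 : ℝ) * 2 ^ j)) ((2 : ℝ) * 2 ^ j), M :=
        setIntegral_mono_set hi (Filter.Eventually.of_forall fun _ => hM) hsub.eventuallyLE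
    _ = 2 ^ j * (4 * M) := by
        rw [setIntegral_const, Real.volume_real_Icc_of_le (by linarith [pow_pos two_pos j (M₀ := ℝ)]),
          smul_eq_mul]
        ring

/-- The slab over `[-2ρ, -ρ]` meets only two dyadic regions. -/
lemma integral_slab_left_le {w : ℝ × ℝ → ℝ} (hw : Continuous w) {T ρ L : ℝ} (hρ : 1 ≤ ρ)
    (hL : ∀ j, ∫ p in Set.Ioc (0 : ℝ) T ×ˢ (dyadicAnn j ∩ Set.Icc (-2 * ρ) (-ρ)), w p ^ 2 ≤
      2 ^ j * L ^ 2) :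
    ∫ p in Set.Ioc (0 : ℝ) T ×ˢ Set.Ioc (-2 * ρ) (-ρ), w p ^ 2 ≤ 3 * ρ * L ^ 2 := by
  obtain ⟨k, hk, hk'⟩ := exists_nat_pow_near hρ (one_lt_two : (1 : ℝ) < 2)
  have hcover : Set.Ioc (0 : ℝ) T ×ˢ Set.Ioc (-2 * ρ) (-ρ) ⊆
      ⋃ j ∈ ({k, k + 1} : Finset ℕ),
        Set.Ioc (0 : ℝ) T ×ˢ (dyadicAnn j ∩ Set.Icc (-2 * ρ) (-ρ)) := by
    rintro ⟨s, x⟩ ⟨hs, hx⟩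
    have hx' : |x| = -x := abs_of_neg (by linarith [hx.2])
    simp only [Set.mem_iUnion, Finset.mem_insert, Finset.mem_singleton, exists_prop]
    by_cases h : |x| < 2 ^ (k + 1)
    · exact ⟨k, Or.inl rfl, hs, mem_dyadicAnn_of_lt (by linarith [hx.2]) h,
        Set.Ioc_subset_Icc_self hx⟩
    · refine ⟨k + 1, Or.inr rfl, hs, mem_dyadicAnn_of_lt (not_lt.1 h) ?_,
        Set.Ioc_subset_Icc_self hx⟩
      rw [pow_succ]
      linarith [hx.1]
  have := setIntegral_le_sum_of_subset_biUnion (μ := volume) (f := fun p => w p ^ 2)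
    (fun p => sq_nonneg _) _ _ hcover
    fun j _ => Continuous.integrableOn_slab (hw.pow 2) T (inter_dyadicAnn_subset_Icc j _)
  rw [Finset.sum_pair (by omega)] at this
  have h1 := hL k
  have h2 := hL (k + 1)
  rw [pow_succ] at h2
  nlinarith [sq_nonneg L]

/-- Duality of the dyadic norms on a slab of bounded width. -/
lemma integral_slab_abs_mul_le {w G : ℝ × ℝ → ℝ} (hw : Continuous w) (hG : Continuous G)
    {T a b S N : ℝ} {B : Set ℝ} (hS : 0 ≤ S) (hB : Set.Ioc a b ⊆ B)
    (hwS : ∀ j, ∫ p in Set.Ioc (0 : ℝ) T ×ˢ (dyadicAnn j ∩ B), w p ^ 2 ≤ 2 ^ j * S ^ 2)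
    (hN : ∀ J, ∑ j ∈ Finset.range J, (2 : ℝ) ^ ((j : ℝ) / 2) *
      Real.sqrt (∫ p in Set.Ioc (0 : ℝ) T ×ˢ (dyadicAnn j ∩ B), G p ^ 2) ≤ N) :
    ∫ p in Set.Ioc (0 : ℝ) T ×ˢ Set.Ioc a b, |w p * G p| ≤ S * N := by
  obtain ⟨J, hJ⟩ := pow_unbounded_of_one_lt (max |a| |b|) (one_lt_two : (1 : ℝ) < 2)
  have hcover : Set.Ioc (0 : ℝ) T ×ˢ Set.Ioc a b ⊆
      ⋃ j ∈ Finset.range (J + 1), Set.Ioc (0 : ℝ) T ×ˢ (dyadicAnn j ∩ B) := by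
    rintro ⟨s, x⟩ ⟨hs, hx⟩
    have hxJ : |x| < 2 ^ (J + 1) := by
      have h1 : |x| ≤ max |a| |b| := abs_le_max_abs_abs hx.1.le hx.2
      have h2 : (2 : ℝ) ^ J ≤ 2 ^ (J + 1) := pow_le_pow_right₀ one_le_two (by omega)
      linarith
    obtain ⟨j, hj, hxj⟩ := exists_mem_dyadicAnn hxJ
    simp only [Set.mem_iUnion, Finset.mem_range, exists_prop]
    exact ⟨j, hj, hs, hxj, hB hx⟩
  refine (setIntegral_le_sum_of_subset_biUnion (μ := volume) (f := fun p => |w p * G p|)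
    (fun p => abs_nonneg _) _ _ hcover fun j _ =>
      Continuous.integrableOn_slab (by fun_prop) T (inter_dyadicAnn_subset_Icc j _)).trans ?_
  refine le_trans ?_ (mul_le_mul_of_nonneg_left (hN (J + 1)) hS)
  rw [Finset.mul_sum]
  refine Finset.sum_le_sum fun j _ => ?_
  refine (setIntegral_abs_mul_le_sqrt_mul_sqrt hw hG
    (Continuous.integrableOn_slab (hw.pow 2) T (inter_dyadicAnn_subset_Icc j _))
    (Continuous.integrableOn_slab (hG.pow 2) T (inter_dyadicAnn_subset_Icc j _))).trans ?_
  have : Real.sqrt (∫ p in Set.Ioc (0 : ℝ) T ×ˢ (dyadicAnn j ∩ B), w p ^ 2) ≤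
      S * (2 : ℝ) ^ ((j : ℝ) / 2) := by
    refine Real.sqrt_le_iff.2 ⟨by positivity, (hwS j).trans_eq ?_⟩
    rw [mul_pow, two_rpow_half_sq, mul_comm]
  rw [← mul_assoc]
  exact mul_le_mul_of_nonneg_right this (Real.sqrt_nonneg _)

/-- Truncated local energy decay for the transport operators `∂_s ± ∂_x`. -/
lemma transport_truncated_LE {w G : ℝ × ℝ → ℝ} (hw : ContDiff ℝ 1 w) (hG : Continuous G)
    {σ : ℝ} (hσ : σ = 1 ∨ σ = -1)
    (hwG : ∀ p, fderiv ℝ w p (1, 0) + σ * fderiv ℝ w p (0, 1) = G p)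
    {R : ℝ} (hR : ∀ s x, R ≤ |x| → w (s, x) = 0) {T ρ L e N : ℝ} (hT : 0 ≤ T) (hρ : 1 ≤ ρ)
    (hL0 : 0 ≤ L) (he0 : 0 ≤ e) (hN0 : 0 ≤ N)
    (hL : ∀ j, ∫ p in Set.Ioc (0 : ℝ) T ×ˢ (dyadicAnn j ∩ Set.Icc (-2 * ρ) (-ρ)), w p ^ 2 ≤
      2 ^ j * L ^ 2)
    (he : ∀ a b, -2 * ρ ≤ a → a ≤ b → ∫ y in a..b, w (0, y) ^ 2 ≤ e ^ 2)
    (hN : ∀ J, ∑ j ∈ Finset.range J, (2 : ℝ) ^ ((j : ℝ) / 2) *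
      Real.sqrt (∫ p in Set.Ioc (0 : ℝ) T ×ˢ (dyadicAnn j ∩ Set.Ici (-2 * ρ)), G p ^ 2) ≤ N)
    (j : ℕ) :
    ∫ p in Set.Ioc (0 : ℝ) T ×ˢ (dyadicAnn j ∩ Set.Ici (-ρ)), w p ^ 2 ≤
      2 ^ j * (8 * (L + e + N)) ^ 2 := by
  have hc : Continuous w := hw.continuous
  set W : ℝ → ℝ := fun x => ∫ s in (0 : ℝ)..T, w (s, x) ^ 2 with hW
  have hWc : Continuous W :=
    intervalIntegral.continuous_parametric_intervalIntegral_of_continuous' (by fun_prop) 0 T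
  have hW0 : ∀ x, 0 ≤ W x := fun x =>
    intervalIntegral.integral_nonneg hT fun _ _ => sq_nonneg _
  have hWR : ∀ x, R ≤ |x| → W x = 0 := fun x hx => by simp [hW, hR _ x hx]
  obtain ⟨x₀, hx₀, hmax⟩ := (isCompact_Icc (a := -ρ) (b := max (-ρ) R)).exists_isMaxOn
    ⟨-ρ, by simp⟩ hWc.continuousOn
  have hM : ∀ x ∈ Set.Ici (-ρ), W x ≤ W x₀ := fun x hx => by
    by_cases hxR : x ≤ max (-ρ) R
    · exact hmax ⟨hx, hxR⟩
    · rw [hWR x (((le_max_right _ _).trans (not_le.1 hxR).le).trans (le_abs_self x))]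
      exact hW0 x₀
  set M := W x₀ with hMdef
  have hM0 : 0 ≤ M := hW0 x₀
  set m := Real.sqrt M
  have hm0 : 0 ≤ m := Real.sqrt_nonneg M
  have hmM : m ^ 2 = M := Real.sq_sqrt hM0
  have hright := integral_slab_sq_le_of_flux_le hc hT hM0 measurableSet_Ici hM
  have hall : ∀ j, ∫ p in Set.Ioc (0 : ℝ) T ×ˢ (dyadicAnn j ∩ Set.Ici (-2 * ρ)), w p ^ 2 ≤
      2 ^ j * (L + 2 * m) ^ 2 := fun j => by
    have hcover : Set.Ioc (0 : ℝ) T ×ˢ (dyadicAnn j ∩ Set.Ici (-2 * ρ)) ⊆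
        ⋃ B ∈ ({Set.Icc (-2 * ρ) (-ρ), Set.Ici (-ρ)} : Finset (Set ℝ)),
          Set.Ioc (0 : ℝ) T ×ˢ (dyadicAnn j ∩ B) := by
      rintro ⟨s, x⟩ ⟨hs, hxj, hx⟩
      simp only [Set.mem_iUnion, Finset.mem_insert, Finset.mem_singleton, exists_prop]
      rcases le_total x (-ρ) with h | h
      · exact ⟨_, Or.inl rfl, hs, hxj, hx, h⟩
      · exact ⟨_, Or.inr rfl, hs, hxj, h⟩
    have := setIntegral_le_sum_of_subset_biUnion (μ := volume) (f := fun p => w p ^ 2)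
      (fun p => sq_nonneg _) _ _ hcover
      fun B _ => Continuous.integrableOn_slab (hc.pow 2) T (inter_dyadicAnn_subset_Icc j _)
    have hne : Set.Icc (-2 * ρ) (-ρ) ≠ Set.Ici (-ρ) := fun h => by
      have h1 : (-ρ + 1) ∈ Set.Icc (-2 * ρ) (-ρ) := h ▸ Set.mem_Ici.2 (by linarith)
      linarith [h1.2]
    rw [Finset.sum_pair hne] at this
    have h1 := hL j
    have h2 := hright j
    have h3 : (0 : ℝ) ≤ 2 ^ j * (L * m) := by positivity
    rw [← hmM] at h2
    nlinarith
  have hwork : ∀ a b, -2 * ρ ≤ a →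
      ∫ p in Set.Ioc (0 : ℝ) T ×ˢ Set.Ioc a b, |w p * G p| ≤ (L + 2 * m) * N := fun a b ha =>
    integral_slab_abs_mul_le hc hG (by positivity) (fun x hx => ha.trans hx.1.le) hall hN
  have hcompare : ∀ a ∈ Set.Ioc (-2 * ρ) (-ρ), M ≤ W a + (e ^ 2 + 2 * ((L + 2 * m) * N)) := by
    intro a ha
    have hax : a ≤ x₀ := ha.2.trans hx₀.1
    rcases hσ with rfl | rfl
    · have h1 := transport_flux_le hw hG hwG hT hax
      have h2 := he a x₀ ha.1.le hax
      have h3 := hwork a x₀ ha.1.le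
      simp only [one_mul] at h1
      linarith
    · have h1 := transport_flux_le hw hG hwG hT hx₀.2
      have h2 := he x₀ _ (ha.1.le.trans hax) hx₀.2
      have h3 := hwork x₀ (max (-ρ) R) (ha.1.le.trans hax)
      have h4 : W (max (-ρ) R) = 0 := hWR _ ((le_max_right _ _).trans (le_abs_self _))
      have h5 := hW0 a
      simp only [hW, hMdef] at h4 h5 ⊢
      linarith
  have haverage : ρ * (M - (e ^ 2 + 2 * ((L + 2 * m) * N))) ≤ 3 * ρ * L ^ 2 := by
    refine le_trans ?_ (integral_slab_left_le hc hρ hL)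
    rw [integral_slab_eq_integral_flux hc hT Set.Ioc_subset_Icc_self]
    have hmono : ∫ x in Set.Ioc (-2 * ρ) (-ρ), (M - (e ^ 2 + 2 * ((L + 2 * m) * N))) ≤
        ∫ x in Set.Ioc (-2 * ρ) (-ρ), W x :=
      setIntegral_mono_on
        ((continuousOn_const.integrableOn_compact isCompact_Icc).mono_set
          Set.Ioc_subset_Icc_self)
        ((hWc.continuousOn.integrableOn_compact isCompact_Icc).mono_set
          Set.Ioc_subset_Icc_self)
        measurableSet_Ioc fun x hx => by linarith [hcompare x hx]
    rw [setIntegral_const, Real.volume_real_Ioc_of_le (by linarith), smul_eq_mul] at hmono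
    refine le_trans (le_of_eq ?_) hmono
    ring
  have hMle : M - (e ^ 2 + 2 * ((L + 2 * m) * N)) ≤ 3 * L ^ 2 := by
    refine le_of_mul_le_mul_left (haverage.trans_eq ?_) (lt_of_lt_of_le one_pos hρ)
    ring
  have hfinal : 4 * M ≤ (8 * (L + e + N)) ^ 2 := by
    rw [← hmM] at hMle ⊢
    nlinarith [sq_nonneg (m - 4 * N), mul_nonneg hL0 he0, mul_nonneg hL0 hN0, mul_nonneg he0 hN0]
  exact (hright j).trans (mul_le_mul_of_nonneg_left hfinal (by positivity))

lemma deriv_fst_eq_fderiv {f : ℝ × ℝ → ℝ} (hf : Differentiable ℝ f) (s x : ℝ) :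
    deriv (fun u => f (u, x)) s = fderiv ℝ f (s, x) (1, 0) :=
  ((hf (s, x)).hasFDerivAt.comp_hasDerivAt s
    ((hasDerivAt_id s).prodMk (hasDerivAt_const s x))).deriv

lemma deriv_snd_eq_fderiv {f : ℝ × ℝ → ℝ} (hf : Differentiable ℝ f) (s x : ℝ) :
    deriv (fun y => f (s, y)) x = fderiv ℝ f (s, x) (0, 1) :=
  ((hf (s, x)).hasFDerivAt.comp_hasDerivAt x
    ((hasDerivAt_const x s).prodMk (hasDerivAt_id x))).deriv

lemma contDiff_pds {φ : ℝ → ℝ → ℝ} (hφ : ContDiff ℝ (⊤ : ℕ∞) fun p : ℝ × ℝ => φ p.1 p.2) :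
    ContDiff ℝ (⊤ : ℕ∞) fun p : ℝ × ℝ => pds φ p.1 p.2 := by
  have h : (fun p : ℝ × ℝ => pds φ p.1 p.2) =
      fun p => fderiv ℝ (fun p : ℝ × ℝ => φ p.1 p.2) p (1, 0) :=
    funext fun p => deriv_fst_eq_fderiv (hφ.differentiable (by simp)) p.1 p.2
  rw [h]
  exact (hφ.fderiv_right (m := (⊤ : ℕ∞)) (by simp)).clm_apply contDiff_const

lemma contDiff_pdrs {φ : ℝ → ℝ → ℝ} (hφ : ContDiff ℝ (⊤ : ℕ∞) fun p : ℝ × ℝ => φ p.1 p.2) :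
    ContDiff ℝ (⊤ : ℕ∞) fun p : ℝ × ℝ => pdrs φ p.1 p.2 := by
  have h : (fun p : ℝ × ℝ => pdrs φ p.1 p.2) =
      fun p => fderiv ℝ (fun p : ℝ × ℝ => φ p.1 p.2) p (0, 1) :=
    funext fun p => deriv_snd_eq_fderiv (hφ.differentiable (by simp)) p.1 p.2
  rw [h]
  exact (hφ.fderiv_right (m := (⊤ : ℕ∞)) (by simp)).clm_apply contDiff_const

lemma boxRW_eq {φ : ℝ → ℝ → ℝ} (hφ : ContDiff ℝ (⊤ : ℕ∞) fun p : ℝ × ℝ => φ p.1 p.2)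
    (p : ℝ × ℝ) :
    boxRW φ p.1 p.2 = -(fderiv ℝ (fun p : ℝ × ℝ => pds φ p.1 p.2) p (1, 0)) +
      fderiv ℝ (fun p : ℝ × ℝ => pdrs φ p.1 p.2) p (0, 1) := by
  rw [← deriv_fst_eq_fderiv ((contDiff_pds hφ).differentiable (by simp)) p.1 p.2,
    ← deriv_snd_eq_fderiv ((contDiff_pdrs hφ).differentiable (by simp)) p.1 p.2]
  rfl

lemma continuous_boxRW {φ : ℝ → ℝ → ℝ}
    (hφ : ContDiff ℝ (⊤ : ℕ∞) fun p : ℝ × ℝ => φ p.1 p.2) :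
    Continuous fun p : ℝ × ℝ => boxRW φ p.1 p.2 := by
  simp only [boxRW_eq hφ]
  have h1 := (contDiff_pds hφ).continuous_fderiv (by simp)
  have h2 := (contDiff_pdrs hφ).continuous_fderiv (by simp)
  fun_prop

/-- The mixed second partial derivatives agree. -/
lemma fderiv_pds_snd_eq_fderiv_pdrs_fst {φ : ℝ → ℝ → ℝ}
    (hφ : ContDiff ℝ (⊤ : ℕ∞) fun p : ℝ × ℝ => φ p.1 p.2) (p : ℝ × ℝ) :
    fderiv ℝ (fun p : ℝ × ℝ => pds φ p.1 p.2) p (0, 1) =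
      fderiv ℝ (fun p : ℝ × ℝ => pdrs φ p.1 p.2) p (1, 0) := by
  have h1 : (fun p : ℝ × ℝ => pds φ p.1 p.2) =
      fun p => fderiv ℝ (fun p : ℝ × ℝ => φ p.1 p.2) p (1, 0) :=
    funext fun p => deriv_fst_eq_fderiv (hφ.differentiable (by simp)) p.1 p.2
  have h2 : (fun p : ℝ × ℝ => pdrs φ p.1 p.2) =
      fun p => fderiv ℝ (fun p : ℝ × ℝ => φ p.1 p.2) p (0, 1) :=
    funext fun p => deriv_snd_eq_fderiv (hφ.differentiable (by simp)) p.1 p.2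
  have hd : DifferentiableAt ℝ (fderiv ℝ fun p : ℝ × ℝ => φ p.1 p.2) p :=
    (hφ.fderiv_right (m := (⊤ : ℕ∞)) (by simp)).differentiable (by simp) p
  have hsymm := (hφ.contDiffAt (x := p)).isSymmSndFDerivAt
    (by rw [minSmoothness_of_isRCLikeNormedField]; exact WithTop.coe_le_coe.2 le_top)
  rw [h1, h2, fderiv_clm_apply hd (differentiableAt_const _),
    fderiv_clm_apply hd (differentiableAt_const _)]
  simpa using hsymm (0, 1) (1, 0)

/-- The spatial support of a function contains that of its derivatives. -/
lemma deriv_eq_zero_of_spatial_support {φ : ℝ → ℝ → ℝ} {R : ℝ}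
    (hR : ∀ s x, R ≤ |x| → φ s x = 0) (s x : ℝ) (hx : R + 1 ≤ |x|) :
    pds φ s x = 0 ∧ pdrs φ s x = 0 := by
  constructor
  · have : (fun u => φ u x) = fun _ => 0 := funext fun u => hR u x (by linarith)
    simp [pds, this]
  · have : (fun y => φ s y) =ᶠ[nhds x] fun _ => 0 := by
      filter_upwards [continuous_abs.continuousAt.eventually
        (lt_mem_nhds (show R < |x| by linarith))] with y hy using hR s y (le_of_lt hy)
    simp [pdrs, this.deriv_eq]

/-- The null derivatives `∂_sφ ∓ ∂_{r*}φ` obey a truncated local energy decay estimate. -/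
lemma null_derivative_truncated_LE {φ : ℝ → ℝ → ℝ}
    (hφ : ContDiff ℝ (⊤ : ℕ∞) fun p : ℝ × ℝ => φ p.1 p.2) {R : ℝ}
    (hP : ∀ s x, R ≤ |x| → pds φ s x = 0) (hQ : ∀ s x, R ≤ |x| → pdrs φ s x = 0)
    (hF : ∀ s x, R ≤ |x| → boxRW φ s x = 0) {σ : ℝ} (hσ : σ = 1 ∨ σ = -1) {T ρ : ℝ}
    (hT : 0 ≤ T) (hρ : 1 ≤ ρ) (j : ℕ) :
    ∫ p in Set.Ioc (0 : ℝ) T ×ˢ (dyadicAnn j ∩ Set.Ici (-ρ)),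
        (pds φ p.1 p.2 - σ * pdrs φ p.1 p.2) ^ 2 ≤
      2 ^ j * (8 * (2 * (LERW (cut (Set.Icc (-2 * ρ) (-ρ)) (pds φ)) T
          + LERW (cut (Set.Icc (-2 * ρ) (-ρ)) (pdrs φ)) T)
        + 2 * Real.sqrt (energyRW φ 0 (-2 * ρ))
        + LERWstar (cut (Set.Ici (-2 * ρ)) (boxRW φ)) T)) ^ 2 := by
  have hPs := contDiff_pds hφ
  have hQs := contDiff_pdrs hφ
  have hPc : Continuous fun p : ℝ × ℝ => pds φ p.1 p.2 := hPs.continuous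
  have hQc : Continuous fun p : ℝ × ℝ => pdrs φ p.1 p.2 := hQs.continuous
  have hFc := continuous_boxRW hφ
  have hσ2 : σ ^ 2 = 1 := by rcases hσ with rfl | rfl <;> norm_num
  have hsq : ∀ a b : ℝ, (a - σ * b) ^ 2 ≤ 2 * (a ^ 2 + b ^ 2) := fun a b => by
    have h1 : (a - σ * b) ^ 2 + (a + σ * b) ^ 2 = 2 * (a ^ 2 + σ ^ 2 * b ^ 2) := by ring
    rw [hσ2, one_mul] at h1
    linarith [sq_nonneg (a + σ * b)]
  have hLs := LERW_nonneg (cut (Set.Icc (-2 * ρ) (-ρ)) (pds φ)) T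
  have hLx := LERW_nonneg (cut (Set.Icc (-2 * ρ) (-ρ)) (pdrs φ)) T
  refine transport_truncated_LE (w := fun p => pds φ p.1 p.2 - σ * pdrs φ p.1 p.2)
    (G := fun p => -boxRW φ p.1 p.2) (R := R)
    ((hPs.sub (contDiff_const.mul hQs)).of_le (WithTop.coe_le_coe.2 le_top)) hFc.neg hσ ?_
    (fun s x hx => by simp [hP s x hx, hQ s x hx]) hT hρ
    (by positivity) (by positivity) (LERWstar_nonneg _ _) ?_ ?_ ?_ j
  · intro p
    have hPd := (hPs.differentiable (by simp) p).hasFDerivAt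
    have hQd := (hQs.differentiable (by simp) p).hasFDerivAt
    have hmix := fderiv_pds_snd_eq_fderiv_pdrs_fst hφ p
    have hw : HasFDerivAt (fun p : ℝ × ℝ => pds φ p.1 p.2 - σ * pdrs φ p.1 p.2) _ p :=
      hPd.sub (hQd.const_mul σ)
    rw [hw.fderiv, boxRW_eq hφ]
    simp only [sub_apply, smul_apply, smul_eq_mul, hmix]
    linear_combination
      (-fderiv ℝ (fun p : ℝ × ℝ => pdrs φ p.1 p.2) p (0, 1)) * hσ2
  · intro j
    have h1 := integral_slab_sq_le_LERW hPc hP (measurableSet_Icc (a := -2 * ρ) (b := -ρ)) T j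
    have h2 := integral_slab_sq_le_LERW hQc hQ (measurableSet_Icc (a := -2 * ρ) (b := -ρ)) T j
    have hsub := inter_dyadicAnn_subset_Icc j (Set.Icc (-2 * ρ) (-ρ))
    have h3 : ∫ p in Set.Ioc (0 : ℝ) T ×ˢ (dyadicAnn j ∩ Set.Icc (-2 * ρ) (-ρ)),
        (pds φ p.1 p.2 - σ * pdrs φ p.1 p.2) ^ 2 ≤
        ∫ p in Set.Ioc (0 : ℝ) T ×ˢ (dyadicAnn j ∩ Set.Icc (-2 * ρ) (-ρ)),
          2 * (pds φ p.1 p.2 ^ 2 + pdrs φ p.1 p.2 ^ 2) :=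
      integral_mono (Continuous.integrableOn_slab (by fun_prop) T hsub)
        (Continuous.integrableOn_slab (by fun_prop) T hsub) fun p => hsq _ _
    rw [integral_const_mul, integral_add
      (Continuous.integrableOn_slab (by fun_prop) T hsub)
      (Continuous.integrableOn_slab (by fun_prop) T hsub)] at h3
    have h4 : (0 : ℝ) ≤ 2 ^ j := by positivity
    nlinarith [mul_nonneg h4 (mul_nonneg hLs hLx), mul_nonneg h4 (sq_nonneg
      (LERW (cut (Set.Icc (-2 * ρ) (-ρ)) (pds φ)) T)), mul_nonneg h4 (sq_nonneg
      (LERW (cut (Set.Icc (-2 * ρ) (-ρ)) (pdrs φ)) T))]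
  · intro a b ha hab
    have hP0 : Continuous fun y => pds φ 0 y := hPc.comp (Continuous.prodMk_right (0 : ℝ))
    have hQ0 : Continuous fun y => pdrs φ 0 y := hQc.comp (Continuous.prodMk_right (0 : ℝ))
    have hE : 0 ≤ energyRW φ 0 (-2 * ρ) :=
      integral_nonneg fun x => add_nonneg (sq_nonneg _) (sq_nonneg _)
    have hi : Integrable fun y => pds φ 0 y ^ 2 + pdrs φ 0 y ^ 2 := by
      refine Continuous.integrable_of_hasCompactSupport (by fun_prop)
        (HasCompactSupport.intro (isCompact_Icc (a := -R) (b := R)) fun x hx => ?_)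
      have hx' : R ≤ |x| := by
        rw [Set.mem_Icc, ← abs_le] at hx
        exact (not_le.1 hx).le
      simp [hP 0 x hx', hQ 0 x hx']
    have hle : ∫ y in a..b, (pds φ 0 y ^ 2 + pdrs φ 0 y ^ 2) ≤ energyRW φ 0 (-2 * ρ) := by
      rw [intervalIntegral.integral_of_le hab]
      exact setIntegral_mono_set hi.integrableOn
        (Filter.Eventually.of_forall fun x => add_nonneg (sq_nonneg _) (sq_nonneg _))
        (Filter.Eventually.of_forall fun x (hx : x ∈ Set.Ioc a b) => lt_of_le_of_lt ha hx.1)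
    have h3 : ∫ y in a..b, (pds φ 0 y - σ * pdrs φ 0 y) ^ 2 ≤
        ∫ y in a..b, 2 * (pds φ 0 y ^ 2 + pdrs φ 0 y ^ 2) :=
      intervalIntegral.integral_mono hab (Continuous.intervalIntegrable (by fun_prop) _ _)
        (Continuous.intervalIntegrable (by fun_prop) _ _) fun y => hsq _ _
    rw [intervalIntegral.integral_const_mul] at h3
    rw [mul_pow, Real.sq_sqrt hE]
    linarith
  · intro J
    simp only [neg_sq]
    exact sum_sqrt_integral_slab_le_LERWstar hFc hF measurableSet_Ici T J

/-- truncated local energy decay for the Regge–Wheeler operator,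
estimate (sph_RW_LE) of the paper.  There is an absolute constant `C` such that for all
`T > 0`, all `r0* < −1`, and all smooth `φ` compactly supported in `r*`:
`‖χ_{[r0*,∞)}∂_sφ‖_{LE_RW} + ‖χ_{[r0*,∞)}∂_{r*}φ‖_{LE_RW}
  ≤ C (‖χ_{[2r0*,r0*]}∂_sφ‖_{LE_RW} + ‖χ_{[2r0*,r0*]}∂_{r*}φ‖_{LE_RW}
        + E_{RW,r*>2r0*}(φ[0])^{1/2} + ‖χ_{[2r0*,∞)}□φ‖_{LE*_RW})`. -/
theorem truncated_LE_regge_wheeler :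
    ∃ C : ℝ, 0 < C ∧ ∀ T : ℝ, 0 < T → ∀ r0s : ℝ, r0s < -1 →
      ∀ φ : ℝ → ℝ → ℝ, ContDiff ℝ (⊤ : ℕ∞) (fun p : ℝ × ℝ => φ p.1 p.2) →
        (∃ R, ∀ s x : ℝ, R ≤ |x| → φ s x = 0) →
        LERW (cut (Set.Ici r0s) (pds φ)) T + LERW (cut (Set.Ici r0s) (pdrs φ)) T
          ≤ C * (LERW (cut (Set.Icc (2 * r0s) r0s) (pds φ)) T
              + LERW (cut (Set.Icc (2 * r0s) r0s) (pdrs φ)) T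
              + Real.sqrt (energyRW φ 0 (2 * r0s))
              + LERWstar (cut (Set.Ici (2 * r0s)) (boxRW φ)) T) := by
  refine ⟨32, by norm_num, fun T hT r0s hr φ hφ ⟨R, hR⟩ => ?_⟩
  obtain ⟨ρ, rfl⟩ : ∃ ρ, r0s = -ρ := ⟨-r0s, by ring⟩
  rw [show (2 : ℝ) * -ρ = -2 * ρ by ring]
  have hP : ∀ s x, R + 1 + 1 ≤ |x| → pds φ s x = 0 := fun s x hx =>
    (deriv_eq_zero_of_spatial_support hR s x (by linarith)).1
  have hQ : ∀ s x, R + 1 + 1 ≤ |x| → pdrs φ s x = 0 := fun s x hx =>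
    (deriv_eq_zero_of_spatial_support hR s x (by linarith)).2
  have hF : ∀ s x, R + 1 + 1 ≤ |x| → boxRW φ s x = 0 := fun s x hx => by
    have h1 := (deriv_eq_zero_of_spatial_support (φ := pds φ)
      (fun s x hx => (deriv_eq_zero_of_spatial_support hR s x hx).1) s x hx).1
    have h2 := (deriv_eq_zero_of_spatial_support (φ := pdrs φ)
      (fun s x hx => (deriv_eq_zero_of_spatial_support hR s x hx).2) s x hx).2
    rw [pds] at h1
    rw [pdrs] at h2
    rw [boxRW, h1, h2]
    simp
  have hPc : Continuous fun p : ℝ × ℝ => pds φ p.1 p.2 := (contDiff_pds hφ).continuous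
  have hQc : Continuous fun p : ℝ × ℝ => pdrs φ p.1 p.2 := (contDiff_pdrs hφ).continuous
  have hv := null_derivative_truncated_LE hφ hP hQ hF (Or.inl rfl) hT.le
    (show 1 ≤ ρ by linarith)
  have hu := null_derivative_truncated_LE hφ hP hQ hF (Or.inr rfl) hT.le
    (show 1 ≤ ρ by linarith)
  have hLs := LERW_nonneg (cut (Set.Icc (-2 * ρ) (-ρ)) (pds φ)) T
  have hLx := LERW_nonneg (cut (Set.Icc (-2 * ρ) (-ρ)) (pdrs φ)) T
  have hN := LERWstar_nonneg (cut (Set.Ici (-2 * ρ)) (boxRW φ)) T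
  have hE := Real.sqrt_nonneg (energyRW φ 0 (-2 * ρ))
  set S : ℝ := 8 * (2 * (LERW (cut (Set.Icc (-2 * ρ) (-ρ)) (pds φ)) T
      + LERW (cut (Set.Icc (-2 * ρ) (-ρ)) (pdrs φ)) T)
    + 2 * Real.sqrt (energyRW φ 0 (-2 * ρ))
    + LERWstar (cut (Set.Ici (-2 * ρ)) (boxRW φ)) T)
  have hS0 : 0 ≤ S := by positivity
  have hsum : ∀ j, (∫ p in Set.Ioc (0 : ℝ) T ×ˢ (dyadicAnn j ∩ Set.Ici (-ρ)),
      pds φ p.1 p.2 ^ 2) + ∫ p in Set.Ioc (0 : ℝ) T ×ˢ (dyadicAnn j ∩ Set.Ici (-ρ)),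
      pdrs φ p.1 p.2 ^ 2 ≤ 2 ^ j * S ^ 2 := fun j => by
    have hsub := inter_dyadicAnn_subset_Icc j (Set.Ici (-ρ))
    have hi : ∀ f : ℝ × ℝ → ℝ, Continuous f →
        IntegrableOn f (Set.Ioc (0 : ℝ) T ×ˢ (dyadicAnn j ∩ Set.Ici (-ρ))) := fun f hf =>
      hf.integrableOn_slab T hsub
    have hadd := add_le_add (hv j) (hu j)
    rw [← integral_add (hi _ (by fun_prop)) (hi _ (by fun_prop))] at hadd
    have hpt : ∀ p : ℝ × ℝ, (pds φ p.1 p.2 - 1 * pdrs φ p.1 p.2) ^ 2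
        + (pds φ p.1 p.2 - -1 * pdrs φ p.1 p.2) ^ 2 =
        2 * (pds φ p.1 p.2 ^ 2 + pdrs φ p.1 p.2 ^ 2) := fun p => by ring
    simp only [hpt] at hadd
    rw [integral_const_mul, integral_add (hi _ (by fun_prop)) (hi _ (by fun_prop))] at hadd
    linarith
  have h1 : LERW (cut (Set.Ici (-ρ)) (pds φ)) T ≤ S :=
    LERW_le_of_integral_slab_sq_le hPc measurableSet_Ici hS0 fun j =>
      le_of_add_le_of_nonneg_left (hsum j) (integral_nonneg fun p => sq_nonneg _)
  have h2 : LERW (cut (Set.Ici (-ρ)) (pdrs φ)) T ≤ S :=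
    LERW_le_of_integral_slab_sq_le hQc measurableSet_Ici hS0 fun j =>
      le_of_add_le_of_nonneg_right (hsum j) (integral_nonneg fun p => sq_nonneg _)
  linarith

end
end

section
/- For each s > 1/2 there is a constant C_s such that for all integers 0 ≤ i ≤ j and every smooth compactly supported ψ : ℝ×S² → ℝ one has ||χ_j ⟨x⟩^{-s} ψ||_{L²} ≤ C_s 2^{(1/2−s)(j−i)} ( ||χ_0 ψ||_{L²} + ||⟨x⟩^{1-s} ∂_x ψ||_{ℓ^∞L²(|x|≤2^i)} ) + C_s 2^{(s−1/2)(j−i)} ||⟨x⟩^{1-s} ∂_x ψ||_{ℓ^∞L²(2^i ≤ |x| ≤ 2^{j+1})}, with C_s independent of i, j and ψ. -/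
open MeasureTheory

noncomputable section

/-- The unit sphere `S² ⊂ ℝ³`. -/
abbrev Sph2 := Metric.sphere (0 : EuclideanSpace ℝ (Fin 3)) 1

/-- The standard surface measure `dV_{S²}` on the unit sphere. -/
def sphMeas : Measure Sph2 := (volume : Measure (EuclideanSpace ℝ (Fin 3))).toSphere

/-- The `L²(A × S², dx dV_{S²})` norm of a function on `ℝ × S²`, for `A ⊆ ℝ`. -/
def L2nrm (A : Set ℝ) (f : ℝ → Sph2 → ℝ) : ℝ :=
  Real.sqrt (∫ x in A, ∫ ω, f x ω ^ 2 ∂sphMeas)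

/-- The set `{2^k ≤ |x| ≤ 2^{k+1}}` whose indicator is `χ_k`. -/
def annAbs (k : ℕ) : Set ℝ := {x : ℝ | (2 : ℝ) ^ k ≤ |x| ∧ |x| ≤ (2 : ℝ) ^ (k + 1)}

/-- The derivative `∂_x ψ` in the first variable. -/
def pdx (ψ : ℝ → Sph2 → ℝ) (x : ℝ) (ω : Sph2) : ℝ := deriv (fun y => ψ y ω) x

/-- The Japanese bracket `⟨x⟩ = (1+x²)^{1/2}`. -/
def jap (x : ℝ) : ℝ := Real.sqrt (1 + x ^ 2)

/-- Smoothness of `ψ : ℝ × S² → ℝ`, encoded as the restriction of a smooth function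
on `ℝ × ℝ³`. -/
def SmoothOnCyl (ψ : ℝ → Sph2 → ℝ) : Prop :=
  ∃ Ψ : ℝ × EuclideanSpace ℝ (Fin 3) → ℝ, ContDiff ℝ (⊤ : ℕ∞) Ψ ∧ ∀ (x : ℝ) (ω : Sph2), ψ x ω = Ψ (x, ω)

/-- `‖f‖_{ℓ^∞L²(|x|≤2^i)} = max( ‖f‖_{L²(|x|<1)}, sup_{0≤k≤i} ‖χ_k f‖_{L²} )`. -/
def linfL2le (i : ℕ) (f : ℝ → Sph2 → ℝ) : ℝ :=
  max (L2nrm {x : ℝ | |x| < 1} f)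
    ((Finset.range (i + 1)).sup' (Finset.nonempty_range_iff.mpr (Nat.succ_ne_zero i))
      fun k => L2nrm (annAbs k) f)

instance : IsFiniteMeasure sphMeas := by unfold sphMeas; infer_instance

lemma isCompact_annAbs (k : ℕ) : IsCompact (annAbs k) := by
  refine Metric.isCompact_of_isClosed_isBounded ?_ ?_
  · exact (isClosed_le continuous_const continuous_abs).inter
      (isClosed_le continuous_abs continuous_const)
  · refine (Metric.isBounded_Icc (-(2 : ℝ) ^ (k + 1)) ((2 : ℝ) ^ (k + 1))).subset ?_
    intro x hx
    exact abs_le.mp hx.2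

lemma volume_annAbs_le (k : ℕ) : volume.real (annAbs k) ≤ 2 * (2 : ℝ) ^ k := by
  have hsub : annAbs k ⊆ Set.Icc ((2 : ℝ) ^ k) (2 ^ (k + 1))
      ∪ Set.Icc (-(2 : ℝ) ^ (k + 1)) (-2 ^ k) := by
    rintro x ⟨h1, h2⟩
    rcases abs_cases x with ⟨h, _⟩ | ⟨h, _⟩
    · left; constructor <;> linarith
    · right; constructor <;> linarith
  have hpos : (0 : ℝ) ≤ 2 ^ k := by positivity
  calc volume.real (annAbs k) ≤ volume.real (Set.Icc ((2 : ℝ) ^ k) (2 ^ (k + 1))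
      ∪ Set.Icc (-(2 : ℝ) ^ (k + 1)) (-2 ^ k)) := by
        refine measureReal_mono hsub ?_
        exact (isCompact_Icc.union isCompact_Icc).measure_lt_top.ne
    _ ≤ _ := measureReal_union_le _ _
    _ = 2 * (2 : ℝ) ^ k := by
        rw [Real.volume_real_Icc_of_le (by rw [pow_succ]; linarith),
          Real.volume_real_Icc_of_le (by rw [pow_succ]; linarith)]
        ring

lemma integrable_prod_sphMeas {F : ℝ → Sph2 → ℝ} (hF : Continuous (Function.uncurry F))
    {A : Set ℝ} (hA : IsCompact A) :
    Integrable (Function.uncurry F) ((volume.restrict A).prod sphMeas) := by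
  have h : IntegrableOn (Function.uncurry F) (A ×ˢ (Set.univ : Set Sph2))
      ((volume : Measure ℝ).prod sphMeas) :=
    hF.continuousOn.integrableOn_compact (hA.prod isCompact_univ)
  rwa [IntegrableOn, ← Measure.prod_restrict, Measure.restrict_univ] at h

lemma L2nrm_sq {f : ℝ → Sph2 → ℝ} (hf : Continuous (Function.uncurry f))
    {A : Set ℝ} (hA : IsCompact A) :
    L2nrm A f ^ 2 = ∫ ω, (∫ x in A, f x ω ^ 2) ∂sphMeas := by
  rw [L2nrm, Real.sq_sqrt (integral_nonneg fun x => integral_nonneg fun ω => sq_nonneg _)]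
  exact integral_integral_swap (integrable_prod_sphMeas (F := fun x ω => f x ω ^ 2)
    (show Continuous fun p : ℝ × Sph2 => Function.uncurry f p ^ 2 from hf.pow 2) hA)

lemma integrable_integral_sq {f : ℝ → Sph2 → ℝ} (hf : Continuous (Function.uncurry f))
    {A : Set ℝ} (hA : IsCompact A) :
    Integrable (fun ω => ∫ x in A, f x ω ^ 2) sphMeas :=
  (integrable_prod_sphMeas (F := fun x ω => f x ω ^ 2)
    (show Continuous fun p : ℝ × Sph2 => Function.uncurry f p ^ 2 from hf.pow 2)
    hA).integral_prod_right

lemma L2nrm_nonneg (A : Set ℝ) (f : ℝ → Sph2 → ℝ) : 0 ≤ L2nrm A f := Real.sqrt_nonneg _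

lemma jap_pos (x : ℝ) : 0 < jap x := Real.sqrt_pos.mpr (by positivity)

lemma continuous_jap : Continuous jap := by unfold jap; fun_prop

lemma continuous_jap_rpow (r : ℝ) : Continuous fun x => jap x ^ r :=
  continuous_jap.rpow_const fun x => Or.inl (jap_pos x).ne'

lemma le_jap {k : ℕ} {x : ℝ} (hx : x ∈ annAbs k) : (2 : ℝ) ^ k ≤ jap x := by
  refine hx.1.trans ?_
  rw [jap, ← Real.sqrt_sq_eq_abs]
  exact Real.sqrt_le_sqrt (by linarith)

lemma jap_le {k : ℕ} {x : ℝ} (hx : x ∈ annAbs k) : jap x ≤ 4 * (2 : ℝ) ^ k := by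
  have h1 : (1 : ℝ) ≤ 2 ^ k := one_le_pow₀ (by norm_num)
  have h2 := hx.2
  rw [jap]
  apply Real.sqrt_le_iff.mpr
  refine ⟨by positivity, ?_⟩
  rw [pow_succ] at h2
  have h3 : x ^ 2 ≤ ((2 : ℝ) ^ k * 2) ^ 2 := by
    rw [← sq_abs x]
    gcongr
  nlinarith

/-- On a dyadic annulus every power of the bracket is comparable to the power of the radius. -/
lemma jap_rpow_le {k : ℕ} {x : ℝ} (hx : x ∈ annAbs k) (r : ℝ) :
    jap x ^ r ≤ (4 : ℝ) ^ |r| * ((2 : ℝ) ^ k) ^ r := by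
  have hk : (0 : ℝ) < 2 ^ k := by positivity
  have h4 : (1 : ℝ) ≤ 4 ^ |r| := Real.one_le_rpow (by norm_num) (abs_nonneg r)
  rcases le_total 0 r with hr | hr
  · rw [abs_of_nonneg hr, ← Real.mul_rpow (by norm_num) hk.le]
    exact Real.rpow_le_rpow (jap_pos x).le (jap_le hx) hr
  · calc jap x ^ r ≤ ((2 : ℝ) ^ k) ^ r := Real.rpow_le_rpow_of_nonpos hk (le_jap hx) hr
      _ ≤ _ := le_mul_of_one_le_left (by positivity) h4

/-- Cauchy–Schwarz on an interval. -/
lemma integral_abs_le_sqrt {g : ℝ → ℝ} (hg : Continuous g) {a b : ℝ} (hab : a ≤ b) :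
    ∫ t in a..b, |g t| ≤ √((b - a) * ∫ t in a..b, g t ^ 2) := by
  apply Real.le_sqrt_of_sq_le
  set I := ∫ t in a..b, |g t| with hI
  set J := ∫ t in a..b, g t ^ 2 with hJ
  have key : ∀ c : ℝ, 0 ≤ J - 2 * c * I + c ^ 2 * (b - a) := by
    intro c
    have h0 : 0 ≤ ∫ t in a..b, (|g t| - c) ^ 2 :=
      intervalIntegral.integral_nonneg hab fun t _ => sq_nonneg _
    have h1 : ∫ t in a..b, (|g t| - c) ^ 2 = J - 2 * c * I + c ^ 2 * (b - a) := by
      have : ∀ t, (|g t| - c) ^ 2 = g t ^ 2 - 2 * c * |g t| + c ^ 2 := by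
        intro t; rw [← sq_abs (g t)]; ring
      simp_rw [this]
      rw [intervalIntegral.integral_add, intervalIntegral.integral_sub,
        intervalIntegral.integral_const_mul, intervalIntegral.integral_const, smul_eq_mul]
      · ring
      all_goals exact Continuous.intervalIntegrable (by fun_prop) _ _
    rwa [h1] at h0
  rcases hab.eq_or_lt with rfl | hlt
  · simp [hI]
  · have hpos : 0 < b - a := sub_pos.mpr hlt
    have h := key (I / (b - a))
    have h2 : J - 2 * (I / (b - a)) * I + (I / (b - a)) ^ 2 * (b - a) = J - I ^ 2 / (b - a) := by
      field_simp; ring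
    rw [h2] at h
    have : I ^ 2 / (b - a) ≤ J := by linarith
    rw [div_le_iff₀ hpos] at this
    linarith

lemma setIntegral_dyadic_le {h : ℝ → ℝ} (hc : Continuous h) (h0 : ∀ x, 0 ≤ h x)
    {ε : ℝ} (hε : ε = 1 ∨ ε = -1) (k : ℕ) :
    ∫ t in (2 : ℝ) ^ k..2 ^ (k + 1), h (ε * t) ≤ ∫ x in annAbs k, h x := by
  have hle : (2 : ℝ) ^ k ≤ 2 ^ (k + 1) := pow_le_pow_right₀ (by norm_num) (Nat.le_succ k)
  have hk : (0 : ℝ) < 2 ^ k := by positivity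
  have mono : ∀ a b : ℝ, a ≤ b → Set.Ioc a b ⊆ annAbs k →
      ∫ t in a..b, h t ≤ ∫ x in annAbs k, h x := by
    intro a b hab hs
    rw [intervalIntegral.integral_of_le hab]
    exact setIntegral_mono_set (hc.continuousOn.integrableOn_compact (isCompact_annAbs k))
      (Filter.Eventually.of_forall h0) hs.eventuallyLE
  rcases hε with rfl | rfl
  · simp only [one_mul]
    refine mono _ _ hle fun x hx => ?_
    have : |x| = x := abs_of_pos (hk.trans hx.1)
    exact ⟨by rw [this]; exact hx.1.le, by rw [this]; exact hx.2⟩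
  · simp only [neg_one_mul]
    rw [intervalIntegral.integral_comp_neg]
    have hle2 : -(2 : ℝ) ^ (k + 1) ≤ -2 ^ k := neg_le_neg hle
    refine mono _ _ hle2 fun x hx => ?_
    have : |x| = -x := abs_of_neg (by linarith [hx.2])
    exact ⟨by rw [this]; linarith [hx.2], by rw [this]; linarith [hx.1]⟩

/-- The increment of `f` over dyadic annuli on one side of the origin. -/
lemma abs_sub_le_sum_dyadic {f : ℝ → ℝ} (hf : Differentiable ℝ f) (hf' : Continuous (deriv f))
    {ε : ℝ} (hε : ε = 1 ∨ ε = -1) {j : ℕ} {x y : ℝ} (hy : 1 ≤ y) (hyx : y ≤ x)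
    (hx : x ≤ 2 ^ (j + 1)) :
    |f (ε * x) - f (ε * y)| ≤
      ∑ k ∈ Finset.range (j + 1), √(2 ^ k * ∫ x in annAbs k, deriv f x ^ 2) := by
  have hε1 : |ε| = 1 := by rcases hε with rfl | rfl <;> simp
  have hder : ∀ t, HasDerivAt (fun t => f (ε * t)) (ε * deriv f (ε * t)) t := by
    intro t
    have h1 : HasDerivAt (fun t : ℝ => ε * t) ε t := by
      simpa using (hasDerivAt_id t).const_mul ε
    have := (hf (ε * t)).hasDerivAt.comp t h1
    rw [mul_comm]; exact this
  have hgc : Continuous fun t => deriv f (ε * t) := by fun_prop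
  have hint : ∀ a b : ℝ, IntervalIntegrable (fun t => |deriv f (ε * t)|) volume a b :=
    fun a b => hgc.abs.intervalIntegrable a b
  have hftc : f (ε * x) - f (ε * y) = ∫ t in y..x, ε * deriv f (ε * t) :=
    (intervalIntegral.integral_eq_sub_of_hasDerivAt (fun t _ => hder t)
      ((continuous_const.mul hgc).intervalIntegrable _ _)).symm
  calc |f (ε * x) - f (ε * y)| ≤ ∫ t in y..x, |ε * deriv f (ε * t)| := by
        rw [hftc]; exact intervalIntegral.abs_integral_le_integral_abs hyx
    _ = ∫ t in y..x, |deriv f (ε * t)| := by simp only [abs_mul, hε1, one_mul]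
    _ ≤ ∫ t in (2 : ℝ) ^ 0..2 ^ (j + 1), |deriv f (ε * t)| := by
        refine intervalIntegral.integral_mono_interval (by simpa using hy) hyx hx
          (Filter.Eventually.of_forall fun t => abs_nonneg _) (hint _ _)
    _ = ∑ k ∈ Finset.range (j + 1), ∫ t in (2 : ℝ) ^ k..2 ^ (k + 1), |deriv f (ε * t)| :=
        (intervalIntegral.sum_integral_adjacent_intervals
          (a := fun k : ℕ => (2 : ℝ) ^ k) fun k _ => hint _ _).symm
    _ ≤ _ := by
        refine Finset.sum_le_sum fun k _ => ?_
        refine (integral_abs_le_sqrt hgc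
          (pow_le_pow_right₀ (by norm_num) (Nat.le_succ k))).trans ?_
        apply Real.sqrt_le_sqrt
        have h2 : (2 : ℝ) ^ (k + 1) - 2 ^ k = 2 ^ k := by ring
        rw [h2]
        exact mul_le_mul_of_nonneg_left
          (setIntegral_dyadic_le (h := fun x => deriv f x ^ 2) (hf'.pow 2)
            (fun x => sq_nonneg _) hε k) (by positivity)

/-- Pointwise bound on the `j`-th annulus by the mass on the unit annulus and the increments. -/
lemma sq_le_dyadic {f : ℝ → ℝ} (hf : Differentiable ℝ f) (hf' : Continuous (deriv f))
    {j : ℕ} {x : ℝ} (hx : x ∈ annAbs j) :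
    f x ^ 2 ≤ 2 * (∫ x in annAbs 0, f x ^ 2) + 2 *
      (∑ k ∈ Finset.range (j + 1), √(2 ^ k * ∫ x in annAbs k, deriv f x ^ 2)) ^ 2 := by
  set T := ∑ k ∈ Finset.range (j + 1), √(2 ^ k * ∫ x in annAbs k, deriv f x ^ 2) with hT
  obtain ⟨ε, hε, hxε⟩ : ∃ ε : ℝ, (ε = 1 ∨ ε = -1) ∧ x = ε * |x| := by
    rcases abs_cases x with ⟨h, _⟩ | ⟨h, _⟩
    · exact ⟨1, Or.inl rfl, by rw [h]; ring⟩
    · exact ⟨-1, Or.inr rfl, by rw [h]; ring⟩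
  have hx1 : 1 ≤ |x| := (one_le_pow₀ (by norm_num)).trans hx.1
  have h22 : (2 : ℝ) ≤ 2 ^ (j + 1) := by
    simpa using pow_le_pow_right₀ (by norm_num : (1 : ℝ) ≤ 2) (Nat.succ_le_succ (Nat.zero_le j))
  have hpt : ∀ y ∈ Set.Icc (1 : ℝ) 2, f x ^ 2 ≤ 2 * f (ε * y) ^ 2 + 2 * T ^ 2 := by
    intro y hy
    have hd : |f x - f (ε * y)| ≤ T := by
      rw [hxε]
      rcases le_total y |x| with h | h
      · exact abs_sub_le_sum_dyadic hf hf' hε hy.1 h hx.2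
      · rw [abs_sub_comm]
        exact abs_sub_le_sum_dyadic hf hf' hε hx1 h (hy.2.trans h22)
    have hsq : (f x - f (ε * y)) ^ 2 ≤ T ^ 2 := by
      rw [← sq_abs]; gcongr
    nlinarith [sq_nonneg (f x - 2 * f (ε * y))]
  have hfc : Continuous fun y => f (ε * y) := by
    have := hf.continuous; fun_prop
  have hfc2 : Continuous fun y => f (ε * y) ^ 2 := hfc.pow 2
  have h1 : ∫ y in (1 : ℝ)..2, f x ^ 2 ≤ ∫ y in (1 : ℝ)..2, (2 * f (ε * y) ^ 2 + 2 * T ^ 2) :=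
    intervalIntegral.integral_mono_on (by norm_num) (by simp)
      (((hfc2.const_mul 2).add continuous_const).intervalIntegrable _ _) hpt
  rw [intervalIntegral.integral_add ((hfc2.const_mul 2).intervalIntegrable _ _) (by simp),
    intervalIntegral.integral_const_mul] at h1
  simp only [intervalIntegral.integral_const, smul_eq_mul] at h1
  have h2 := setIntegral_dyadic_le (h := fun x => f x ^ 2) (hf.continuous.pow 2)
    (fun x => sq_nonneg _) hε 0
  norm_num at h1 h2
  linarith

/-- Weighted Cauchy–Schwarz for a finite sum of square roots. -/
lemma sq_sum_sqrt_le (S : Finset ℕ) {q w : ℕ → ℝ} (hq : ∀ k, 0 ≤ q k) (hw : ∀ k, 0 < w k) :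
    (∑ k ∈ S, √(q k)) ^ 2 ≤ (∑ k ∈ S, w k) * ∑ k ∈ S, q k / w k :=
  Finset.sum_sq_le_sum_mul_sum_of_sq_le_mul S (fun k _ => (hw k).le)
    (fun k _ => div_nonneg (hq k) (hw k).le)
    fun k _ => by rw [Real.sq_sqrt (hq k), mul_div_cancel₀ _ (hw k).ne']

/-- The unweighted derivative mass on an annulus in terms of the weighted one. -/
lemma setIntegral_sq_le_weighted {g : ℝ → ℝ} (hg : Continuous g) (s : ℝ) (k : ℕ) :
    ∫ x in annAbs k, g x ^ 2 ≤ ((4 : ℝ) ^ |s - 1| * ((2 : ℝ) ^ k) ^ (s - 1)) ^ 2 *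
      ∫ x in annAbs k, (jap x ^ (1 - s) * g x) ^ 2 := by
  rw [← integral_const_mul]
  have hj := continuous_jap_rpow (1 - s)
  refine setIntegral_mono_on
    ((hg.pow 2).continuousOn.integrableOn_compact (isCompact_annAbs k))
    (ContinuousOn.integrableOn_compact (isCompact_annAbs k)
      (Continuous.continuousOn (by fun_prop)))
    (isCompact_annAbs k).measurableSet fun x hx => ?_
  have h1 : g x = jap x ^ (s - 1) * (jap x ^ (1 - s) * g x) := by
    rw [← mul_assoc, ← Real.rpow_add (jap_pos x)]; simp
  calc g x ^ 2 = (jap x ^ (s - 1)) ^ 2 * (jap x ^ (1 - s) * g x) ^ 2 := by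
        rw [← mul_pow, ← h1]
    _ ≤ _ := by
        have := jap_rpow_le hx (s - 1)
        have := Real.rpow_nonneg (jap_pos x).le (s - 1)
        gcongr

lemma sq_sum_sqrt_dyadic_le {g : ℝ → ℝ} (hg : Continuous g) (s : ℝ) (S : Finset ℕ) :
    (∑ k ∈ S, √(2 ^ k * ∫ x in annAbs k, g x ^ 2)) ^ 2 ≤
      (∑ k ∈ S, ((2 : ℝ) ^ k) ^ (s - 1 / 2)) * ∑ k ∈ S, ((4 : ℝ) ^ |s - 1|) ^ 2 *
        ((2 : ℝ) ^ k) ^ (s - 1 / 2) * ∫ x in annAbs k, (jap x ^ (1 - s) * g x) ^ 2 := by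
  refine (sq_sum_sqrt_le S (w := fun k => ((2 : ℝ) ^ k) ^ (s - 1 / 2))
    (fun k => mul_nonneg (by positivity) (integral_nonneg fun x => sq_nonneg _))
    (fun k => by positivity)).trans ?_
  refine mul_le_mul_of_nonneg_left (Finset.sum_le_sum fun k _ => ?_)
    (Finset.sum_nonneg fun k _ => by positivity)
  have hk : (0 : ℝ) < 2 ^ k := by positivity
  rw [div_le_iff₀ (by positivity)]
  have hpow : (2 : ℝ) ^ k * (((2 : ℝ) ^ k) ^ (s - 1)) ^ 2
      = ((2 : ℝ) ^ k) ^ (s - 1 / 2) * ((2 : ℝ) ^ k) ^ (s - 1 / 2) := by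
    nth_rewrite 1 [← Real.rpow_one ((2 : ℝ) ^ k)]
    rw [sq, ← Real.rpow_add hk, ← Real.rpow_add hk, ← Real.rpow_add hk]
    congr 1; ring
  calc (2 : ℝ) ^ k * ∫ x in annAbs k, g x ^ 2
      ≤ 2 ^ k * (((4 : ℝ) ^ |s - 1| * ((2 : ℝ) ^ k) ^ (s - 1)) ^ 2 *
        ∫ x in annAbs k, (jap x ^ (1 - s) * g x) ^ 2) :=
        mul_le_mul_of_nonneg_left (setIntegral_sq_le_weighted hg s k) hk.le
    _ = ((4 : ℝ) ^ |s - 1|) ^ 2 * ((2 : ℝ) ^ k * (((2 : ℝ) ^ k) ^ (s - 1)) ^ 2) *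
        ∫ x in annAbs k, (jap x ^ (1 - s) * g x) ^ 2 := by ring
    _ = _ := by rw [hpow]; ring

/-- The one-dimensional form of the estimate, in squared form. -/
lemma setIntegral_weighted_sq_le {f : ℝ → ℝ} (hf : Differentiable ℝ f)
    (hf' : Continuous (deriv f)) {s : ℝ} (hs : 1 / 2 < s) (i j : ℕ) :
    ∫ x in annAbs j, (jap x ^ (-s) * f x) ^ 2 ≤
      8 * (((2 : ℝ) ^ j) ^ (1 / 2 - s)) ^ 2 * ((∫ x in annAbs 0, f x ^ 2)
        + (∑ k ∈ Finset.range (i + 1), ((2 : ℝ) ^ k) ^ (s - 1 / 2)) *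
          (∑ k ∈ Finset.range (i + 1), ((4 : ℝ) ^ |s - 1|) ^ 2 * ((2 : ℝ) ^ k) ^ (s - 1 / 2) *
            ∫ x in annAbs k, (jap x ^ (1 - s) * deriv f x) ^ 2)
        + (∑ k ∈ Finset.Icc i j, ((2 : ℝ) ^ k) ^ (s - 1 / 2)) *
          (∑ k ∈ Finset.Icc i j, ((4 : ℝ) ^ |s - 1|) ^ 2 * ((2 : ℝ) ^ k) ^ (s - 1 / 2) *
            ∫ x in annAbs k, (jap x ^ (1 - s) * deriv f x) ^ 2)) := by
  have hA := sq_sum_sqrt_dyadic_le hf' s (Finset.range (i + 1))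
  have hB := sq_sum_sqrt_dyadic_le hf' s (Finset.Icc i j)
  set P := ∫ x in annAbs 0, f x ^ 2
  set u : ℕ → ℝ := fun k => √(2 ^ k * ∫ x in annAbs k, deriv f x ^ 2)
  set a := ∑ k ∈ Finset.range (i + 1), u k with ha
  set b := ∑ k ∈ Finset.Icc i j, u k with hb
  have hu : ∀ k, 0 ≤ u k := fun k => Real.sqrt_nonneg _
  have hP : 0 ≤ P := integral_nonneg fun x => sq_nonneg _
  have hsum : ∑ k ∈ Finset.range (j + 1), u k ≤ a + b := by
    rw [ha, hb, ← Finset.sum_union_inter]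
    refine le_add_of_le_of_nonneg (Finset.sum_le_sum_of_subset_of_nonneg ?_ fun k _ _ => hu k)
      (Finset.sum_nonneg fun k _ => hu k)
    intro k hk
    simp only [Finset.mem_union, Finset.mem_range, Finset.mem_Icc] at hk ⊢
    omega
  have hsum0 : 0 ≤ ∑ k ∈ Finset.range (j + 1), u k := Finset.sum_nonneg fun k _ => hu k
  have hk : (0 : ℝ) < 2 ^ j := by positivity
  set M := (((2 : ℝ) ^ j) ^ (-s)) ^ 2 * (4 * (P + a ^ 2 + b ^ 2)) with hM
  have hM0 : 0 ≤ M := by positivity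
  have hpt : ∀ x ∈ annAbs j, (jap x ^ (-s) * f x) ^ 2 ≤ M := by
    intro x hx
    have h1 : f x ^ 2 ≤ 4 * (P + a ^ 2 + b ^ 2) := by
      have h2 := sq_le_dyadic hf hf' hx
      have h3 : (∑ k ∈ Finset.range (j + 1), u k) ^ 2 ≤ (a + b) ^ 2 := by gcongr
      have h4 : f x ^ 2 ≤ 2 * P + 2 * (∑ k ∈ Finset.range (j + 1), u k) ^ 2 := h2
      nlinarith [sq_nonneg (a - b)]
    have h2 : jap x ^ (-s) ≤ ((2 : ℝ) ^ j) ^ (-s) :=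
      Real.rpow_le_rpow_of_nonpos hk (le_jap hx) (by linarith)
    have h3 := Real.rpow_nonneg (jap_pos x).le (-s)
    rw [mul_pow, hM]
    gcongr
  have hj := continuous_jap_rpow (-s)
  have hfc := hf.continuous
  have hint : ∫ x in annAbs j, (jap x ^ (-s) * f x) ^ 2 ≤ ∫ x in annAbs j, M :=
    setIntegral_mono_on (ContinuousOn.integrableOn_compact (isCompact_annAbs j)
      (Continuous.continuousOn (by fun_prop)))
      (continuous_const.continuousOn.integrableOn_compact (isCompact_annAbs j))
      (isCompact_annAbs j).measurableSet hpt
  rw [setIntegral_const, smul_eq_mul] at hint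
  have hpow : (2 : ℝ) ^ j * (((2 : ℝ) ^ j) ^ (-s)) ^ 2 = (((2 : ℝ) ^ j) ^ (1 / 2 - s)) ^ 2 := by
    nth_rewrite 1 [← Real.rpow_one ((2 : ℝ) ^ j)]
    rw [sq, sq, ← Real.rpow_add hk, ← Real.rpow_add hk, ← Real.rpow_add hk]
    congr 1; ring
  calc ∫ x in annAbs j, (jap x ^ (-s) * f x) ^ 2 ≤ volume.real (annAbs j) * M := hint
    _ ≤ 2 * (2 : ℝ) ^ j * M := mul_le_mul_of_nonneg_right (volume_annAbs_le j) hM0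
    _ = 8 * ((2 : ℝ) ^ j * (((2 : ℝ) ^ j) ^ (-s)) ^ 2) * (P + a ^ 2 + b ^ 2) := by rw [hM]; ring
    _ ≤ _ := by
        rw [hpow]
        gcongr

/-- Geometric sums of dyadic powers are controlled by their largest term. -/
lemma sum_dyadic_rpow_le {σ : ℝ} (hσ : 0 < σ) (n : ℕ) :
    ∑ k ∈ Finset.range (n + 1), ((2 : ℝ) ^ k) ^ σ
      ≤ (2 : ℝ) ^ σ / ((2 : ℝ) ^ σ - 1) * ((2 : ℝ) ^ n) ^ σ := by
  have h1 : (1 : ℝ) < 2 ^ σ := Real.one_lt_rpow (by norm_num) hσ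
  have hk : ∀ k : ℕ, ((2 : ℝ) ^ k) ^ σ = ((2 : ℝ) ^ σ) ^ k := fun k => by
    rw [← Real.rpow_natCast_mul (by norm_num), mul_comm, Real.rpow_mul_natCast (by norm_num)]
  simp_rw [hk]
  rw [geom_sum_eq h1.ne', div_mul_eq_mul_div, ← pow_succ']
  have : 0 < (2 : ℝ) ^ σ - 1 := by linarith
  gcongr
  linarith

lemma SmoothOnCyl.continuous {ψ : ℝ → Sph2 → ℝ} (h : SmoothOnCyl ψ) :
    Continuous (Function.uncurry ψ) := by
  obtain ⟨Ψ, hΨ, he⟩ := h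
  have : Function.uncurry ψ = fun p : ℝ × Sph2 => Ψ (p.1, (p.2 : EuclideanSpace ℝ (Fin 3))) := by
    ext ⟨x, ω⟩; exact he x ω
  rw [this]
  have := hΨ.continuous
  fun_prop

lemma SmoothOnCyl.hasDerivAt {ψ : ℝ → Sph2 → ℝ} {Ψ : ℝ × EuclideanSpace ℝ (Fin 3) → ℝ}
    (hΨ : ContDiff ℝ (⊤ : ℕ∞) Ψ) (he : ∀ (x : ℝ) (ω : Sph2), ψ x ω = Ψ (x, ω))
    (x : ℝ) (ω : Sph2) :
    HasDerivAt (fun y => ψ y ω) (fderiv ℝ Ψ (x, (ω : EuclideanSpace ℝ (Fin 3))) (1, 0)) x := by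
  simp_rw [he]
  exact ((hΨ.differentiable (by simp)) _).hasFDerivAt.comp_hasDerivAt x
    ((hasDerivAt_id x).prodMk (hasDerivAt_const x _))

lemma SmoothOnCyl.differentiable {ψ : ℝ → Sph2 → ℝ} (h : SmoothOnCyl ψ) (ω : Sph2) :
    Differentiable ℝ fun y => ψ y ω := by
  obtain ⟨Ψ, hΨ, he⟩ := h
  exact fun x => (SmoothOnCyl.hasDerivAt hΨ he x ω).differentiableAt

lemma SmoothOnCyl.continuous_pdx {ψ : ℝ → Sph2 → ℝ} (h : SmoothOnCyl ψ) :
    Continuous (Function.uncurry (pdx ψ)) := by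
  obtain ⟨Ψ, hΨ, he⟩ := h
  have : Function.uncurry (pdx ψ) = fun p : ℝ × Sph2 =>
      fderiv ℝ Ψ (p.1, (p.2 : EuclideanSpace ℝ (Fin 3))) (1, 0) := by
    ext ⟨x, ω⟩; exact (SmoothOnCyl.hasDerivAt hΨ he x ω).deriv
  rw [this]
  have := hΨ.continuous_fderiv (by simp)
  fun_prop

/-- The estimate in squared form, with the dyadic masses still summed. -/
lemma L2nrm_sq_le_sum {ψ : ℝ → Sph2 → ℝ} (h : SmoothOnCyl ψ) {s : ℝ} (hs : 1 / 2 < s)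
    (i j : ℕ) :
    L2nrm (annAbs j) (fun x ω => jap x ^ (-s) * ψ x ω) ^ 2 ≤
      8 * (((2 : ℝ) ^ j) ^ (1 / 2 - s)) ^ 2 * (L2nrm (annAbs 0) ψ ^ 2
        + (∑ k ∈ Finset.range (i + 1), ((2 : ℝ) ^ k) ^ (s - 1 / 2)) *
          (∑ k ∈ Finset.range (i + 1), ((4 : ℝ) ^ |s - 1|) ^ 2 * ((2 : ℝ) ^ k) ^ (s - 1 / 2) *
            L2nrm (annAbs k) (fun x ω => jap x ^ (1 - s) * pdx ψ x ω) ^ 2)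
        + (∑ k ∈ Finset.Icc i j, ((2 : ℝ) ^ k) ^ (s - 1 / 2)) *
          (∑ k ∈ Finset.Icc i j, ((4 : ℝ) ^ |s - 1|) ^ 2 * ((2 : ℝ) ^ k) ^ (s - 1 / 2) *
            L2nrm (annAbs k) (fun x ω => jap x ^ (1 - s) * pdx ψ x ω) ^ 2)) := by
  have c0 := h.continuous
  have c1 : Continuous (Function.uncurry fun x ω => jap x ^ (-s) * ψ x ω) :=
    ((continuous_jap_rpow (-s)).comp continuous_fst).mul c0
  have c2 : Continuous (Function.uncurry fun x ω => jap x ^ (1 - s) * pdx ψ x ω) :=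
    ((continuous_jap_rpow (1 - s)).comp continuous_fst).mul h.continuous_pdx
  have hI := fun k => integrable_integral_sq c2 (isCompact_annAbs k)
  have hI0 := integrable_integral_sq c0 (isCompact_annAbs 0)
  have hsum : ∀ S : Finset ℕ, Integrable (fun ω => ∑ k ∈ S, ((4 : ℝ) ^ |s - 1|) ^ 2 *
      ((2 : ℝ) ^ k) ^ (s - 1 / 2) * ∫ x in annAbs k, (jap x ^ (1 - s) * pdx ψ x ω) ^ 2) sphMeas :=
    fun S => integrable_finsetSum S fun k _ => (hI k).const_mul _
  rw [L2nrm_sq c1 (isCompact_annAbs j), L2nrm_sq c0 (isCompact_annAbs 0)]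
  have hswap : ∀ S : Finset ℕ, ∑ k ∈ S, ((4 : ℝ) ^ |s - 1|) ^ 2 * ((2 : ℝ) ^ k) ^ (s - 1 / 2) *
      L2nrm (annAbs k) (fun x ω => jap x ^ (1 - s) * pdx ψ x ω) ^ 2 =
      ∫ ω, (∑ k ∈ S, ((4 : ℝ) ^ |s - 1|) ^ 2 * ((2 : ℝ) ^ k) ^ (s - 1 / 2) *
        ∫ x in annAbs k, (jap x ^ (1 - s) * pdx ψ x ω) ^ 2) ∂sphMeas := by
    intro S
    rw [integral_finsetSum _ fun k _ => (hI k).const_mul _]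
    refine Finset.sum_congr rfl fun k _ => ?_
    rw [integral_const_mul, L2nrm_sq c2 (isCompact_annAbs k)]
  have hI1 := hI0.add ((hsum (Finset.range (i + 1))).const_mul
    (∑ k ∈ Finset.range (i + 1), ((2 : ℝ) ^ k) ^ (s - 1 / 2)))
  simp only [Pi.add_def] at hI1
  rw [hswap, hswap, ← integral_const_mul, ← integral_const_mul,
    ← integral_add hI0 ((hsum _).const_mul _),
    ← integral_add hI1 ((hsum _).const_mul _),
    ← integral_const_mul]
  refine integral_mono (integrable_integral_sq c1 (isCompact_annAbs j))
    ((hI1.add ((hsum _).const_mul _)).const_mul _) fun ω => ?_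
  have hd : Continuous (deriv fun y => ψ y ω) :=
    h.continuous_pdx.comp (continuous_id.prodMk continuous_const)
  exact setIntegral_weighted_sq_le (h.differentiable ω) hd hs i j

lemma sum_mul_sum_le {S : Finset ℕ} {w D : ℕ → ℝ} {K A G : ℝ} (hK : 0 ≤ K)
    (hw : ∀ k, 0 ≤ w k) (hD : ∀ k ∈ S, 0 ≤ D k ∧ D k ≤ A) (hG : ∑ k ∈ S, w k ≤ G) :
    (∑ k ∈ S, w k) * (∑ k ∈ S, K * w k * D k ^ 2) ≤ K * (G * A) ^ 2 := by
  have hS : 0 ≤ ∑ k ∈ S, w k := Finset.sum_nonneg fun k _ => hw k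
  have h1 : ∑ k ∈ S, K * w k * D k ^ 2 ≤ K * (∑ k ∈ S, w k) * A ^ 2 := by
    rw [Finset.mul_sum, Finset.sum_mul]
    refine Finset.sum_le_sum fun k hk => ?_
    have := hw k
    have := (hD k hk).1
    have := (hD k hk).2
    gcongr
  calc (∑ k ∈ S, w k) * (∑ k ∈ S, K * w k * D k ^ 2)
      ≤ (∑ k ∈ S, w k) * (K * (∑ k ∈ S, w k) * A ^ 2) := mul_le_mul_of_nonneg_left h1 hS
    _ = K * (∑ k ∈ S, w k) ^ 2 * A ^ 2 := by ring
    _ ≤ K * G ^ 2 * A ^ 2 := by gcongr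
    _ = _ := by ring

/-- improved dyadic Hardy estimate, eq. (improved_hardy) of the paper.
For each `s > 1/2` there is `C_s` such that for all `0 ≤ i ≤ j` and all smooth compactly
supported `ψ : ℝ×S² → ℝ`:
`‖χ_j ⟨x⟩^{-s}ψ‖_{L²} ≤ C_s 2^{(1/2−s)(j−i)} ( ‖χ_0ψ‖ + ‖⟨x⟩^{1-s}∂_xψ‖_{ℓ^∞L²(|x|≤2^i)} )
    + C_s 2^{(s−1/2)(j−i)} ‖⟨x⟩^{1-s}∂_xψ‖_{ℓ^∞L²(2^i≤|x|≤2^{j+1})}`. -/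
theorem improved_dyadic_hardy (s : ℝ) (hs : 1 / 2 < s) :
    ∃ C : ℝ, ∀ i j : ℕ, (hij : i ≤ j) → ∀ ψ : ℝ → Sph2 → ℝ, SmoothOnCyl ψ →
      (∃ R : ℝ, ∀ (x : ℝ) (ω : Sph2), R ≤ |x| → ψ x ω = 0) →
      L2nrm (annAbs j) (fun x ω => jap x ^ (-s) * ψ x ω)
        ≤ C * (2 : ℝ) ^ ((1 / 2 - s) * ((j : ℝ) - (i : ℝ))) *
            (L2nrm (annAbs 0) ψ
              + linfL2le i (fun x ω => jap x ^ (1 - s) * pdx ψ x ω))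
          + C * (2 : ℝ) ^ ((s - 1 / 2) * ((j : ℝ) - (i : ℝ))) *
            ((Finset.Icc i j).sup' (Finset.nonempty_Icc.mpr hij)
              fun k => L2nrm (annAbs k) (fun x ω => jap x ^ (1 - s) * pdx ψ x ω)) := by
  set σ := s - 1 / 2 with hσdef
  have hσ : 0 < σ := sub_pos.mpr hs
  set c := (2 : ℝ) ^ σ / ((2 : ℝ) ^ σ - 1) with hc
  have h2σ : (1 : ℝ) < 2 ^ σ := Real.one_lt_rpow (by norm_num) hσ
  have hc1 : 1 ≤ c := by
    rw [hc, one_le_div (by linarith)]; linarith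
  set K := (4 : ℝ) ^ |s - 1| with hKdef
  have hK1 : 1 ≤ K := Real.one_le_rpow (by norm_num) (abs_nonneg _)
  have hKc : 1 ≤ K * c := one_le_mul_of_one_le_of_one_le hK1 hc1
  refine ⟨3 * (K * c), fun i j hij ψ hψ _ => ?_⟩
  have key := L2nrm_sq_le_sum hψ hs i j
  set D : ℕ → ℝ := fun k => L2nrm (annAbs k) (fun x ω => jap x ^ (1 - s) * pdx ψ x ω) with hD
  set A := linfL2le i (fun x ω => jap x ^ (1 - s) * pdx ψ x ω) with hA
  set B := (Finset.Icc i j).sup' (Finset.nonempty_Icc.mpr hij) D with hB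
  set N := L2nrm (annAbs 0) ψ
  set L := L2nrm (annAbs j) (fun x ω => jap x ^ (-s) * ψ x ω)
  have hD0 : ∀ k, 0 ≤ D k := fun k => L2nrm_nonneg _ _
  have hN : 0 ≤ N := L2nrm_nonneg _ _
  have hA0 : 0 ≤ A := le_max_of_le_left (L2nrm_nonneg _ _)
  have hDA : ∀ k ∈ Finset.range (i + 1), 0 ≤ D k ∧ D k ≤ A := fun k hk =>
    ⟨hD0 k, le_max_of_le_right (Finset.le_sup' D hk)⟩
  have hDB : ∀ k ∈ Finset.Icc i j, 0 ≤ D k ∧ D k ≤ B := fun k hk =>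
    ⟨hD0 k, Finset.le_sup' D hk⟩
  have hB0 : 0 ≤ B := (hD0 i).trans (hDB i (Finset.left_mem_Icc.mpr hij)).2
  have hw : ∀ k : ℕ, 0 ≤ ((2 : ℝ) ^ k) ^ σ := fun k => by positivity
  have hGj : ∑ k ∈ Finset.Icc i j, ((2 : ℝ) ^ k) ^ σ ≤ c * ((2 : ℝ) ^ j) ^ σ := by
    refine (Finset.sum_le_sum_of_subset_of_nonneg ?_ fun k _ _ => hw k).trans
      (sum_dyadic_rpow_le hσ j)
    intro k hk
    simp only [Finset.mem_range, Finset.mem_Icc] at hk ⊢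
    omega
  have h1 := sum_mul_sum_le (sq_nonneg K) hw hDA (sum_dyadic_rpow_le hσ i)
  have h2 := sum_mul_sum_le (sq_nonneg K) hw hDB hGj
  have hpow : ∀ n : ℕ, ∀ r : ℝ, ((2 : ℝ) ^ n) ^ r = (2 : ℝ) ^ (n * r) := fun n r => by
    rw [Real.rpow_natCast_mul (by norm_num)]
  set p := (2 : ℝ) ^ ((1 / 2 - s) * ((j : ℝ) - (i : ℝ))) with hp
  set q := (2 : ℝ) ^ ((s - 1 / 2) * ((j : ℝ) - (i : ℝ))) with hq
  set m := ((2 : ℝ) ^ j) ^ (1 / 2 - s) with hm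
  have hji : (0 : ℝ) ≤ (j : ℝ) - i := sub_nonneg.mpr (by exact_mod_cast hij)
  have hm0 : 0 ≤ m := by positivity
  have hp0 : 0 ≤ p := by positivity
  have hq1 : 1 ≤ q := Real.one_le_rpow (by norm_num) (mul_nonneg hσ.le hji)
  have hmi : m * ((2 : ℝ) ^ i) ^ σ = p := by
    rw [hm, hpow, hpow, ← Real.rpow_add (by norm_num), hp]
    congr 1; rw [hσdef]; ring
  have hmj : m * ((2 : ℝ) ^ j) ^ σ = 1 := by
    rw [hm, ← Real.rpow_add (by positivity), hσdef]; simp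
  have hmp : m ≤ p := by
    rw [← hmi]
    exact le_mul_of_one_le_right hm0
      (Real.one_le_rpow (one_le_pow₀ (by norm_num)) hσ.le)
  have hL : L ^ 2 ≤ 8 * ((m * N) ^ 2 + (K * c * (p * A)) ^ 2 + (K * c * B) ^ 2) := by
    calc L ^ 2 ≤ 8 * m ^ 2 * (N ^ 2 + K ^ 2 * (c * ((2 : ℝ) ^ i) ^ σ * A) ^ 2
          + K ^ 2 * (c * ((2 : ℝ) ^ j) ^ σ * B) ^ 2) := by
          refine key.trans ?_
          gcongr
      _ = 8 * ((m * N) ^ 2 + (K * c * (m * ((2 : ℝ) ^ i) ^ σ * A)) ^ 2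
          + (K * c * (m * ((2 : ℝ) ^ j) ^ σ * B)) ^ 2) := by ring
      _ = _ := by rw [hmi, hmj, one_mul]
  have hmN : m * N ≤ K * c * (p * N) :=
    (mul_le_mul_of_nonneg_right hmp hN).trans
      (le_mul_of_one_le_left (mul_nonneg hp0 hN) hKc)
  have hBq : K * c * B ≤ K * c * (q * B) := by
    have := le_mul_of_one_le_left hB0 hq1
    gcongr
  have hX : 0 ≤ m * N := mul_nonneg hm0 hN
  have hY : 0 ≤ K * c * (p * A) := by positivity
  have hZ : 0 ≤ K * c * B := by positivity
  have hL2 : L ≤ 3 * (m * N + K * c * (p * A) + K * c * B) := by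
    refine abs_le_of_sq_le_sq' ?_ (by positivity) |>.2
    nlinarith [mul_nonneg hX hY, mul_nonneg hX hZ, mul_nonneg hY hZ]
  calc L ≤ 3 * (m * N + K * c * (p * A) + K * c * B) := hL2
    _ ≤ 3 * (K * c * (p * N) + K * c * (p * A) + K * c * (q * B)) := by gcongr
    _ = _ := by ring

end
end
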